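/- If A is low for 1-randomness, then A is low for weak 2-random tests: for every generalized Martin-Löf test relative to A with intersection ⋂_n V_n^A, there is a generalized Martin-Löf test (with no oracle) whose intersection ⋂_n U_n contains ⋂_n V_n^A. -/

import Mathlib

open MeasureTheory Filter

namespace LMD

/-- Codes for partial functions recursive in an oracle. -/
inductive OracleCode : Type
  | zero : OracleCode
  | succ : OracleCode
  | left : OracleCode
  | right : OracleCode
  | oracle : OracleCode
  | pair : OracleCode → OracleCode → OracleCode
  | comp : OracleCode → OracleCode → OracleCode
  | prec : OracleCode → OracleCode → OracleCode
  | rfind' : OracleCode → OracleCode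

namespace OracleCode

/-- Evaluation of an oracle code relative to a (total) oracle `O : ℕ → ℕ`. -/
def eval (O : ℕ → ℕ) : OracleCode → ℕ →. ℕ
  | zero => pure 0
  | succ => Nat.succ
  | left => ↑fun n : ℕ => n.unpair.1
  | right => ↑fun n : ℕ => n.unpair.2
  | oracle => ↑fun n : ℕ => O n
  | pair cf cg => fun n => Nat.pair <$> eval O cf n <*> eval O cg n
  | comp cf cg => fun n => eval O cg n >>= eval O cf
  | prec cf cg =>
    Nat.unpaired fun a n =>
      n.rec (eval O cf a) fun y IH => do
        let i ← IH
        eval O cg (Nat.pair a (Nat.pair y i))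
  | rfind' cf =>
    Nat.unpaired fun a m =>
      (Nat.rfind fun n => (fun m => m = 0) <$> eval O cf (Nat.pair a (n + m))).map (· + m)

/-- A Gödel numbering of oracle codes. -/
def encodeCode : OracleCode → ℕ
  | zero => 0
  | succ => 1
  | left => 2
  | right => 3
  | oracle => 4
  | pair cf cg => 4 * Nat.pair (encodeCode cf) (encodeCode cg) + 5
  | comp cf cg => 4 * Nat.pair (encodeCode cf) (encodeCode cg) + 6
  | prec cf cg => 4 * Nat.pair (encodeCode cf) (encodeCode cg) + 7
  | rfind' cf => 4 * encodeCode cf + 8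

end OracleCode

/-- `f` is partial recursive in the oracle `O`. -/
def RecursiveIn (O : ℕ → ℕ) (f : ℕ →. ℕ) : Prop := ∃ c : OracleCode, c.eval O = f

/-- The characteristic function of a set of naturals. -/
noncomputable def chi (A : Set ℕ) : ℕ → ℕ := A.indicator fun _ => 1

/-- Turing reducibility between sets of naturals. -/
def TuringLE (A B : Set ℕ) : Prop := RecursiveIn (chi B) (chi A)

/-- The Turing jump of a set of naturals. -/
def jump (B : Set ℕ) : Set ℕ :=
  {e | ∃ c : OracleCode, c.encodeCode = e ∧ (c.eval (chi B) e).Dom}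

/-- The open subset of Cantor space generated by a set of finite binary strings. -/
def Cyl (W : Set (List Bool)) : Set (ℕ → Bool) :=
  {X | ∃ σ ∈ W, ∀ i : Fin σ.length, X i = σ.get i}

/-- The fair-coin product measure on Cantor space, realized as the pushforward of
Lebesgue measure on `[0,1)` under the binary expansion map. -/
noncomputable def mu : Measure (ℕ → Bool) :=
  Measure.map (fun x n => decide (⌊x * 2 ^ (n + 1)⌋₊ % 2 = 1))
    (volume.restrict (Set.Ico (0 : ℝ) 1))

/-- `W` is a c.e.-in-`A` set of binary strings. -/
def CeIn (A : Set ℕ) (W : Set (List Bool)) : Prop :=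
  ∃ c : OracleCode, ∀ σ : List Bool, σ ∈ W ↔ (c.eval (chi A) (Encodable.encode σ)).Dom

/-- `W` is a uniformly c.e.-in-`A` sequence of sets of binary strings. -/
def CeSeqIn (A : Set ℕ) (W : ℕ → Set (List Bool)) : Prop :=
  ∃ c : OracleCode, ∀ (n : ℕ) (σ : List Bool),
    σ ∈ W n ↔ (c.eval (chi A) (Nat.pair n (Encodable.encode σ))).Dom

/-- A Martin-Löf test relative to `A`. -/
def MLTest (A : Set ℕ) (U : ℕ → Set (ℕ → Bool)) : Prop :=
  ∃ W : ℕ → Set (List Bool), CeSeqIn A W ∧ (∀ n, U n = Cyl (W n)) ∧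
    (∀ n, U (n + 1) ⊆ U n) ∧ ∀ n, mu (U n) ≤ 2⁻¹ ^ n

/-- `X` is Martin-Löf random relative to `A`. -/
def MLRandom (A : Set ℕ) (X : ℕ → Bool) : Prop :=
  ∀ U : ℕ → Set (ℕ → Bool), MLTest A U → X ∉ ⋂ n, U n

/-- `A ≤_LR B`: every `B`-random is `A`-random. -/
def LRle (A B : Set ℕ) : Prop := ∀ X : ℕ → Bool, MLRandom B X → MLRandom A X

/-- Evaluation of an oracle machine on binary strings. -/
def evalStr (c : OracleCode) (O : ℕ → ℕ) (σ : List Bool) : Part (List Bool) :=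
  (c.eval O (Encodable.encode σ)).bind fun m => Part.ofOption (Encodable.decode m)

/-- `c` is a prefix-free oracle machine: for every oracle its domain is prefix-free. -/
def PrefixFreeMachine (c : OracleCode) : Prop :=
  ∀ (O : ℕ → ℕ) (σ₁ σ₂ : List Bool), σ₁ <+: σ₂ →
    (evalStr c O σ₁).Dom → (evalStr c O σ₂).Dom → σ₁ = σ₂

/-- `u` is a universal prefix-free oracle machine. -/
def UniversalPFM (u : OracleCode) : Prop :=
  PrefixFreeMachine u ∧
    ∀ c : OracleCode, PrefixFreeMachine c → ∃ d : ℕ, ∀ (O : ℕ → ℕ) (σ τ : List Bool),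
      τ ∈ evalStr c O σ → ∃ σ' : List Bool, τ ∈ evalStr u O σ' ∧ σ'.length ≤ σ.length + d

/-- Prefix-free Kolmogorov complexity relative to the oracle `O`,
measured by the universal machine `u` (`⊤` if `τ` is not in the range). -/
noncomputable def K (u : OracleCode) (O : ℕ → ℕ) (τ : List Bool) : ℕ∞ :=
  ⨅ σ ∈ {σ : List Bool | τ ∈ evalStr u O σ}, (σ.length : ℕ∞)

/-- `A ≤_LK B` with respect to the universal machine `u`. -/
def LKle (u : OracleCode) (A B : Set ℕ) : Prop :=
  ∃ d : ℕ, ∀ τ : List Bool, K u (chi B) τ ≤ K u (chi A) τ + (d : ℕ∞)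


/-- A generalized Martin-Löf test relative to `A`. -/
def GenMLTest (A : Set ℕ) (U : ℕ → Set (ℕ → Bool)) : Prop :=
  ∃ W : ℕ → Set (List Bool), CeSeqIn A W ∧ (∀ n, U n = Cyl (W n)) ∧
    (∀ n, U (n + 1) ⊆ U n) ∧ mu (⋂ n, U n) = 0

/-- `X` is weakly 2-random relative to `A`. -/
def W2Random (A : Set ℕ) (X : ℕ → Bool) : Prop :=
  ∀ U : ℕ → Set (ℕ → Bool), GenMLTest A U → X ∉ ⋂ n, U n

/-- `A` is low for weak 2-random tests. -/
def LowForW2Tests (A : Set ℕ) : Prop :=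
  ∀ V : ℕ → Set (ℕ → Bool), GenMLTest A V →
    ∃ U : ℕ → Set (ℕ → Bool), GenMLTest ∅ U ∧ (⋂ n, V n) ⊆ ⋂ n, U n

/-- `A` is low for weak 2-randomness. -/
def LowForW2Randomness (A : Set ℕ) : Prop :=
  ∀ X : ℕ → Bool, W2Random ∅ X → W2Random A X

/-- Evaluation of an oracle code relative to a partial oracle. -/
def OracleCode.peval (T : ℕ →. ℕ) : OracleCode → ℕ →. ℕ
  | .zero => pure 0
  | .succ => Nat.succ
  | .left => ↑fun n : ℕ => n.unpair.1
  | .right => ↑fun n : ℕ => n.unpair.2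
  | .oracle => T
  | .pair cf cg => fun n => Nat.pair <$> peval T cf n <*> peval T cg n
  | .comp cf cg => fun n => peval T cg n >>= peval T cf
  | .prec cf cg =>
    Nat.unpaired fun a n =>
      n.rec (peval T cf a) fun y IH => do
        let i ← IH
        peval T cg (Nat.pair a (Nat.pair y i))
  | .rfind' cf =>
    Nat.unpaired fun a m =>
      (Nat.rfind fun n => (fun m => m = 0) <$> peval T cf (Nat.pair a (n + m))).map (· + m)

theorem OracleCode.peval_coe (O : ℕ → ℕ) (c : OracleCode) :
    c.peval (fun n => Part.some (O n)) = c.eval O := by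
  induction c with
  | pair cf cg hf hg => simp only [peval, eval, hf, hg]; rfl
  | comp cf cg hf hg => simp only [peval, eval, hf, hg]; rfl
  | prec cf cg hf hg => simp only [peval, eval, hf, hg]; rfl
  | rfind' cf hf => simp only [peval, eval, hf]; rfl
  | _ => rfl

theorem OracleCode.mem_peval_comp {T : ℕ →. ℕ} {cf cg : OracleCode} {x y : ℕ} :
    y ∈ (OracleCode.comp cf cg).peval T x ↔ ∃ a ∈ cg.peval T x, y ∈ cf.peval T a :=
  Part.mem_bind_iff

theorem OracleCode.mem_peval_rfind' {T : ℕ →. ℕ} {cf : OracleCode} {x y : ℕ} :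
    y ∈ (OracleCode.rfind' cf).peval T x ↔
      ∃ n, (0 ∈ cf.peval T (Nat.pair x.unpair.1 (n + x.unpair.2)) ∧
        ∀ k < n, ∃ b ∈ cf.peval T (Nat.pair x.unpair.1 (k + x.unpair.2)), b ≠ 0) ∧
        n + x.unpair.2 = y := by
  refine (Part.mem_map_iff _).trans (exists_congr fun n => and_congr_left fun _ => ?_)
  refine Nat.mem_rfind.trans (and_congr ?_ (forall₂_congr fun k _ => ?_))
  · refine (Part.mem_map_iff _).trans ?_
    simp
  · refine (Part.mem_map_iff _).trans ?_
    simp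

theorem OracleCode.peval_mono {T T' : ℕ →. ℕ} (h : ∀ i, ∀ y ∈ T i, y ∈ T' i) (c : OracleCode) :
    ∀ x, ∀ y ∈ c.peval T x, y ∈ c.peval T' x := by
  induction c with
  | oracle => exact h
  | pair cf cg hf hg =>
    intro x y
    simp only [peval, Seq.seq, Part.map_eq_map, Part.mem_bind_iff, Part.mem_map_iff]
    rintro ⟨a, ⟨b, hb, rfl⟩, d, hd, rfl⟩
    exact ⟨_, ⟨b, hf _ _ hb, rfl⟩, d, hg _ _ hd, rfl⟩
  | comp cf cg hf hg =>
    intro x y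
    simp only [mem_peval_comp]
    rintro ⟨a, ha, hy⟩
    exact ⟨a, hg _ _ ha, hf _ _ hy⟩
  | prec cf cg hf hg =>
    intro x
    simp only [peval, Nat.unpaired]
    induction x.unpair.2 with
    | zero => exact hf _
    | succ n ih =>
      intro y
      simp only [Part.bind_eq_bind, Part.mem_bind_iff]
      rintro ⟨a, ha, hy⟩
      exact ⟨a, ih _ ha, hg _ _ hy⟩
  | rfind' cf hf =>
    intro x y
    simp only [mem_peval_rfind']
    rintro ⟨n, ⟨hb, hn⟩, rfl⟩
    refine ⟨n, ⟨hf _ _ hb, fun k hk => ?_⟩, rfl⟩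
    obtain ⟨d, hd, hd0⟩ := hn k hk
    exact ⟨d, hf _ _ hd, hd0⟩
  | _ => exact fun _ _ hy => hy

theorem OracleCode.exists_peval {T : ℕ → ℕ →. ℕ} {O : ℕ →. ℕ}
    (hT : ∀ m n, m ≤ n → ∀ i, ∀ y ∈ T m i, y ∈ T n i)
    (h : ∀ i, ∀ y ∈ O i, ∃ m, y ∈ T m i) (c : OracleCode) :
    ∀ x, ∀ y ∈ c.peval O x, ∃ m, y ∈ c.peval (T m) x := by
  have up : ∀ (c : OracleCode) {m n x y}, m ≤ n → y ∈ c.peval (T m) x → y ∈ c.peval (T n) x :=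
    fun c m n x y hmn hy => c.peval_mono (hT m n hmn) x y hy
  induction c with
  | oracle => exact h
  | pair cf cg hf hg =>
    intro x y
    simp only [peval, Seq.seq, Part.map_eq_map, Part.mem_bind_iff, Part.mem_map_iff]
    rintro ⟨a, ⟨b, hb, rfl⟩, d, hd, rfl⟩
    obtain ⟨m, hm⟩ := hf _ _ hb
    obtain ⟨n, hn⟩ := hg _ _ hd
    exact ⟨max m n, _, ⟨b, up _ (le_max_left _ _) hm, rfl⟩, d, up _ (le_max_right _ _) hn, rfl⟩
  | comp cf cg hf hg =>
    intro x y
    simp only [mem_peval_comp]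
    rintro ⟨a, ha, hy⟩
    obtain ⟨m, hm⟩ := hg _ _ ha
    obtain ⟨n, hn⟩ := hf _ _ hy
    exact ⟨max m n, a, up _ (le_max_left _ _) hm, up _ (le_max_right _ _) hn⟩
  | prec cf cg hf hg =>
    intro x
    obtain ⟨a, k, rfl⟩ : ∃ a k, x = Nat.pair a k := ⟨_, _, (Nat.pair_unpair x).symm⟩
    induction k with
    | zero =>
      intro y hy
      simp only [peval, Nat.unpaired, Nat.unpair_pair] at hy ⊢
      exact hf _ _ hy
    | succ k ih =>
      intro y hy
      simp only [peval, Nat.unpaired, Nat.unpair_pair, Part.bind_eq_bind,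
        Part.mem_bind_iff] at hy ih ⊢
      obtain ⟨b, hb, hy⟩ := hy
      obtain ⟨m, hm⟩ := ih _ hb
      obtain ⟨n, hn⟩ := hg _ _ hy
      refine ⟨max m n, b, ?_, up _ (le_max_right _ _) hn⟩
      have := up (.prec cf cg) (x := Nat.pair a k) (y := b) (le_max_left m n)
      simp only [peval, Nat.unpaired, Nat.unpair_pair] at this
      exact this hm
  | rfind' cf hf =>
    intro x y
    simp only [mem_peval_rfind']
    rintro ⟨n, ⟨hb, hn⟩, rfl⟩
    have hk : ∀ k ≤ n, ∃ M, ∀ j < k,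
        ∃ a ∈ cf.peval (T M) (Nat.pair x.unpair.1 (j + x.unpair.2)), a ≠ 0 := by
      intro k
      induction k with
      | zero => exact fun _ => ⟨0, fun j hj => absurd hj (Nat.not_lt_zero j)⟩
      | succ k ih =>
        intro hk
        obtain ⟨M, hM⟩ := ih (by omega)
        obtain ⟨d, hd, hd0⟩ := hn k (by omega)
        obtain ⟨m, hm⟩ := hf _ _ hd
        refine ⟨max M m, fun j hj => ?_⟩
        rcases Nat.lt_succ_iff_lt_or_eq.1 hj with hj | rfl
        · obtain ⟨a, ha, ha0⟩ := hM j hj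
          exact ⟨a, up _ (le_max_left _ _) ha, ha0⟩
        · exact ⟨d, up _ (le_max_right _ _) hm, hd0⟩
    obtain ⟨M, hM⟩ := hk n le_rfl
    obtain ⟨m, hm⟩ := hf _ _ hb
    refine ⟨max M m, n, ⟨up _ (le_max_right _ _) hm, fun j hj => ?_⟩, rfl⟩
    obtain ⟨a, ha, ha0⟩ := hM j hj
    exact ⟨a, up _ (le_max_left _ _) ha, ha0⟩
  | zero => exact fun _ _ hy => ⟨0, hy⟩
  | succ => exact fun _ _ hy => ⟨0, hy⟩
  | left => exact fun _ _ hy => ⟨0, hy⟩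
  | right => exact fun _ _ hy => ⟨0, hy⟩

theorem OracleCode.partrec_peval {α : Type*} [Primcodable α] {T : α → ℕ →. ℕ} (hT : Partrec₂ T)
    (c : OracleCode) : Partrec₂ fun a x => c.peval (T a) x := by
  induction c with
  | zero => exact (Computable.const 0).partrec
  | succ => exact (Computable.succ.comp Computable.snd).partrec
  | left => exact (Computable.fst.comp (Computable.unpair.comp Computable.snd)).partrec
  | right => exact (Computable.snd.comp (Computable.unpair.comp Computable.snd)).partrec
  | oracle => exact hT
  | pair cf cg hf hg =>
    have : Partrec fun p : α × ℕ => (cf.peval (T p.1) p.2).bind fun a =>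
        (cg.peval (T p.1) p.2).map fun b => Nat.pair a b := by
      refine Partrec.bind hf ?_
      refine Partrec.map (hg.comp (Computable.fst.comp Computable.fst)
        (Computable.snd.comp Computable.fst)) ?_
      exact Primrec₂.natPair.to_comp.comp (Computable.snd.comp Computable.fst) Computable.snd
    refine this.of_eq fun p => ?_
    simp [peval, Seq.seq, Part.bind_map]
  | comp cf cg hf hg =>
    exact Partrec.bind hg (hf.comp (Computable.fst.comp Computable.fst) Computable.snd)
  | prec cf cg hf hg =>
    have hu : Computable fun p : α × ℕ => p.2.unpair := Computable.unpair.comp Computable.snd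
    have := Partrec.nat_rec (f := fun p : α × ℕ => p.2.unpair.2)
      (g := fun p : α × ℕ => cf.peval (T p.1) p.2.unpair.1)
      (h := fun p q => cg.peval (T p.1) (Nat.pair p.2.unpair.1 (Nat.pair q.1 q.2)))
      (Computable.snd.comp hu) (hf.comp Computable.fst (Computable.fst.comp hu))
      (hg.comp (Computable.fst.comp Computable.fst)
        (Primrec₂.natPair.to_comp.comp (Computable.fst.comp (hu.comp Computable.fst))
          (Primrec₂.natPair.to_comp.comp (Computable.fst.comp Computable.snd)
            (Computable.snd.comp Computable.snd))))
    exact this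
  | rfind' cf hf =>
    have hu : Computable fun p : α × ℕ => p.2.unpair := Computable.unpair.comp Computable.snd
    have h1 : Partrec₂ fun (p : α × ℕ) (n : ℕ) => (cf.peval (T p.1)
        (Nat.pair p.2.unpair.1 (n + p.2.unpair.2))).map fun m => decide (m = 0) := by
      refine Partrec.map (hf.comp (Computable.fst.comp Computable.fst)
        (Primrec₂.natPair.to_comp.comp (Computable.fst.comp (hu.comp Computable.fst))
          (Primrec.nat_add.to_comp.comp Computable.snd
            (Computable.snd.comp (hu.comp Computable.fst))))) ?_
      exact ((PrimrecRel.decide Primrec.eq).to_comp.comp Computable.snd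
        (Computable.const 0) : Computable fun q : ((α × ℕ) × ℕ) × ℕ => decide (q.2 = 0)).to₂
    exact (Partrec.rfind h1).map
      (Primrec.nat_add.to_comp.comp Computable.snd (Computable.snd.comp (hu.comp Computable.fst)))

/-- Partial recursive functions have oracle codes, uniformly in the oracle. -/
theorem exists_oracleCode {f : ℕ →. ℕ} (hf : Nat.Partrec f) :
    ∃ c : OracleCode, ∀ O, c.eval O = f := by
  induction hf with
  | zero => exact ⟨.zero, fun _ => rfl⟩
  | succ => exact ⟨.succ, fun _ => rfl⟩
  | left => exact ⟨.left, fun _ => rfl⟩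
  | right => exact ⟨.right, fun _ => rfl⟩
  | pair _ _ hf hg =>
    obtain ⟨cf, hf⟩ := hf
    obtain ⟨cg, hg⟩ := hg
    exact ⟨.pair cf cg, fun O => by simp only [OracleCode.eval, hf, hg]; rfl⟩
  | comp _ _ hf hg =>
    obtain ⟨cf, hf⟩ := hf
    obtain ⟨cg, hg⟩ := hg
    exact ⟨.comp cf cg, fun O => by simp only [OracleCode.eval, hf, hg]; rfl⟩
  | prec _ _ hf hg =>
    obtain ⟨cf, hf⟩ := hf
    obtain ⟨cg, hg⟩ := hg
    exact ⟨.prec cf cg, fun O => by simp only [OracleCode.eval, hf, hg]; rfl⟩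
  | rfind _ hf =>
    obtain ⟨cf, hf⟩ := hf
    obtain ⟨cg, hg⟩ : ∃ cg : OracleCode, ∀ O n, cg.eval O n = Part.some (Nat.pair n 0) := by
      refine ⟨.pair (.pair .left .right) .zero, fun O n => ?_⟩
      simp [OracleCode.eval, Seq.seq]
      rfl
    refine ⟨.comp (.rfind' cf) cg, fun O => ?_⟩
    funext n
    simp [OracleCode.eval, hf, hg]
    exact Part.map_id' (fun _ => rfl) _

section Primrec

attribute [fun_prop] Primrec PrimrecPred

variable {α β γ : Type*} [Primcodable α] [Primcodable β] [Primcodable γ]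

@[fun_prop] theorem primrec_id' : Primrec (fun a : α => a) := Primrec.id

@[fun_prop] theorem primrec_const' (b : β) : Primrec (fun _ : α => b) := Primrec.const b

@[fun_prop] theorem primrec_comp' {g : β → γ} {f : α → β} (hg : Primrec g) (hf : Primrec f) :
    Primrec (fun a => g (f a)) := hg.comp hf

@[fun_prop] theorem primrec_fst' {f : α → β × γ} (hf : Primrec f) :
    Primrec (fun a => (f a).1) := Primrec.fst.comp hf

@[fun_prop] theorem primrec_snd' {f : α → β × γ} (hf : Primrec f) :
    Primrec (fun a => (f a).2) := Primrec.snd.comp hf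

@[fun_prop] theorem primrec_prodMk' {f : α → β} {g : α → γ} (hf : Primrec f) (hg : Primrec g) :
    Primrec (fun a => (f a, g a)) := hf.pair hg

@[fun_prop] theorem primrec_add' {f g : α → ℕ} (hf : Primrec f) (hg : Primrec g) :
    Primrec (fun a => f a + g a) := Primrec.nat_add.comp hf hg

@[fun_prop] theorem primrec_sub' {f g : α → ℕ} (hf : Primrec f) (hg : Primrec g) :
    Primrec (fun a => f a - g a) := Primrec.nat_sub.comp hf hg

@[fun_prop] theorem primrec_mul' {f g : α → ℕ} (hf : Primrec f) (hg : Primrec g) :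
    Primrec (fun a => f a * g a) := Primrec.nat_mul.comp hf hg

@[fun_prop] theorem primrec_mod' {f g : α → ℕ} (hf : Primrec f) (hg : Primrec g) :
    Primrec (fun a => f a % g a) := Primrec.nat_mod.comp hf hg

@[fun_prop] theorem primrec_div' {f g : α → ℕ} (hf : Primrec f) (hg : Primrec g) :
    Primrec (fun a => f a / g a) := Primrec.nat_div.comp hf hg

@[fun_prop] theorem primrec_pow' {f g : α → ℕ} (hf : Primrec f) (hg : Primrec g) :
    Primrec (fun a => f a ^ g a) :=
  (Primrec₂.unpaired'.1 Nat.Primrec.pow).comp hf hg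

@[fun_prop] theorem primrec_natPair' {f g : α → ℕ} (hf : Primrec f) (hg : Primrec g) :
    Primrec (fun a => Nat.pair (f a) (g a)) := Primrec₂.natPair.comp hf hg

@[fun_prop] theorem primrec_unpair' {f : α → ℕ} (hf : Primrec f) :
    Primrec (fun a => Nat.unpair (f a)) := Primrec.unpair.comp hf

@[fun_prop] theorem primrec_encode' {f : α → β} (hf : Primrec f) :
    Primrec (fun a => Encodable.encode (f a)) := Primrec.encode.comp hf

@[fun_prop] theorem primrecPred_le' {f g : α → ℕ} (hf : Primrec f) (hg : Primrec g) :
    PrimrecPred (fun a => f a ≤ g a) := Primrec.nat_le.comp hf hg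

@[fun_prop] theorem primrecPred_lt' {f g : α → ℕ} (hf : Primrec f) (hg : Primrec g) :
    PrimrecPred (fun a => f a < g a) := Primrec.nat_lt.comp hf hg

@[fun_prop] theorem primrecPred_eq' [DecidableEq β] {f g : α → β}
    (hf : Primrec f) (hg : Primrec g) :
    PrimrecPred (fun a => f a = g a) := Primrec.eq.comp hf hg

@[fun_prop] theorem primrecPred_and' {f g : α → Prop} (hf : PrimrecPred f) (hg : PrimrecPred g) :
    PrimrecPred (fun a => f a ∧ g a) := hf.and hg

@[fun_prop] theorem primrecPred_or' {f g : α → Prop} (hf : PrimrecPred f) (hg : PrimrecPred g) :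
    PrimrecPred (fun a => f a ∨ g a) := hf.or hg

@[fun_prop] theorem primrecPred_not' {f : α → Prop} (hf : PrimrecPred f) :
    PrimrecPred (fun a => ¬ f a) := hf.not

@[fun_prop] theorem primrecPred_comp' {g : β → Prop} {f : α → β} (hg : PrimrecPred g)
    (hf : Primrec f) : PrimrecPred (fun a => g (f a)) := hg.comp hf

@[fun_prop] theorem primrec_testBit' {f g : α → ℕ} (hf : Primrec f) (hg : Primrec g) :
    Primrec (fun a => (f a).testBit (g a)) := by
  have h : PrimrecPred fun a => f a / 2 ^ g a % 2 = 1 := by fun_prop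
  refine h.decide.of_eq fun a => ?_
  rw [Nat.testBit_eq_decide_div_mod_eq]

theorem PrimrecPred.exists_lt' {R : α → ℕ → Prop} {f : α → ℕ}
    (hR : PrimrecPred fun p : α × ℕ => R p.1 p.2) (hf : Primrec f) :
    PrimrecPred fun a => ∃ x < f a, R a x := by
  refine (PrimrecRel.exists_mem_list (R := fun x a => R a x) ?_ |>.comp
    (Primrec.list_range.comp hf) Primrec.id).of_eq fun a => by simp
  exact hR.comp (Primrec.snd.pair Primrec.fst)

theorem PrimrecPred.forall_lt' {R : α → ℕ → Prop} {f : α → ℕ}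
    (hR : PrimrecPred fun p : α × ℕ => R p.1 p.2) (hf : Primrec f) :
    PrimrecPred fun a => ∀ x < f a, R a x := by
  refine (PrimrecRel.forall_mem_list (R := fun x a => R a x) ?_ |>.comp
    (Primrec.list_range.comp hf) Primrec.id).of_eq fun a => by simp
  exact hR.comp (Primrec.snd.pair Primrec.fst)

theorem Primrec.sum_range {g : α → ℕ → ℕ} {f : α → ℕ}
    (hg : Primrec fun p : α × ℕ => g p.1 p.2) (hf : Primrec f) :
    Primrec fun a => ∑ x ∈ Finset.range (f a), g a x := by
  have h : Primrec₂ fun (a : α) (p : ℕ × ℕ) => p.2 + g a p.1 := by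
    have : Primrec fun q : α × ℕ × ℕ => q.2.2 + g q.1 q.2.1 :=
      Primrec.nat_add.comp (Primrec.snd.comp Primrec.snd)
        (hg.comp (Primrec.fst.pair (Primrec.fst.comp Primrec.snd)))
    exact this
  refine (Primrec.nat_rec' hf (Primrec.const 0) h).of_eq fun a => ?_
  induction f a with
  | zero => rfl
  | succ n ih => rw [Finset.sum_range_succ, ← ih]

open Classical in
theorem Primrec.card_filter_range {R : α → ℕ → Prop} {f : α → ℕ}
    (hR : PrimrecPred fun p : α × ℕ => R p.1 p.2) (hf : Primrec f) :
    Primrec fun a => ((Finset.range (f a)).filter (R a)).card := by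
  have := Primrec.sum_range (g := fun a x => if R a x then 1 else 0)
    (Primrec.ite hR (Primrec.const 1) (Primrec.const 0)) hf
  exact this.of_eq fun a => by rw [Finset.card_filter]

end Primrec

/-- The number whose binary digits are the first `n` values of `X`. -/
def seg (X : ℕ → Bool) : ℕ → ℕ
  | 0 => 0
  | n + 1 => seg X n + (X n).toNat * 2 ^ n

theorem seg_lt (X : ℕ → Bool) (n : ℕ) : seg X n < 2 ^ n := by
  induction n with
  | zero => simp [seg]
  | succ n ih => simp only [seg, pow_succ]; cases X n <;> simp <;> omega

theorem seg_mod (X : ℕ → Bool) {m n : ℕ} (h : m ≤ n) : seg X n % 2 ^ m = seg X m := by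
  induction n, h using Nat.le_induction with
  | base => exact Nat.mod_eq_of_lt (seg_lt X m)
  | succ n hmn ih =>
    obtain ⟨k, rfl⟩ := Nat.exists_eq_add_of_le hmn
    rw [seg, pow_add, ← mul_assoc, mul_comm _ (2 ^ m), mul_assoc, Nat.add_mul_mod_self_left, ih]

theorem testBit_seg (X : ℕ → Bool) {i n : ℕ} (h : i < n) : (seg X n).testBit i = X i := by
  have h1 := Nat.testBit_mod_two_pow (seg X n) (i + 1) i
  rw [seg_mod X h] at h1
  simp only [Nat.lt_succ_self, decide_true, Bool.true_and] at h1
  rw [← h1, seg, Nat.testBit_eq_decide_div_mod_eq]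
  have h2 := seg_lt X i
  rw [Nat.add_mul_div_right _ _ (by positivity), Nat.div_eq_of_lt h2]
  cases X i <;> simp

theorem seg_testBit {v n : ℕ} (h : v < 2 ^ n) : seg v.testBit n = v := by
  apply Nat.eq_of_testBit_eq
  intro i
  by_cases hi : i < n
  · exact testBit_seg _ hi
  · have h2 : 2 ^ n ≤ 2 ^ i := Nat.pow_le_pow_right (by norm_num) (by omega)
    rw [Nat.testBit_lt_two_pow (lt_of_lt_of_le h h2),
      Nat.testBit_lt_two_pow (lt_of_lt_of_le (seg_lt _ _) h2)]

theorem seg_eq_iff {X Y : ℕ → Bool} {n : ℕ} : seg X n = seg Y n ↔ ∀ i < n, X i = Y i := by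
  constructor
  · intro h i hi
    rw [← testBit_seg X hi, h, testBit_seg Y hi]
  · intro h
    induction n with
    | zero => rfl
    | succ n ih => rw [seg, seg, ih fun i hi => h i (by omega), h n (by omega)]

/-- The binary string of length `n` with digits those of `v`. -/
def bits (n v : ℕ) : List Bool := (List.range n).map v.testBit

/-- The number with binary digits given by `σ`. -/
def val (σ : List Bool) : ℕ := σ.foldr (fun b acc => b.toNat + 2 * acc) 0

theorem bits_val (σ : List Bool) : bits σ.length (val σ) = σ := by
  induction σ with
  | nil => rfl
  | cons b σ ih =>
    rw [bits, List.length_cons, List.range_succ_eq_map, List.map_cons, List.map_map]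
    rw [bits] at ih
    congr 1
    · rw [val, List.foldr_cons, Nat.testBit_zero]
      cases b <;> simp
    · refine Eq.trans ?_ ih
      refine List.map_congr_left fun i _ => ?_
      simp only [Function.comp, val, List.foldr_cons, Nat.testBit_succ]
      congr 1
      cases b <;> simp
      omega

theorem length_bits (n v : ℕ) : (bits n v).length = n := by simp [bits]

theorem val_bits {n v : ℕ} (h : v < 2 ^ n) : val (bits n v) = v := by
  have h1 : ∀ σ : List Bool, val σ < 2 ^ σ.length := by
    intro σ
    induction σ with
    | nil => simp [val]
    | cons b σ ih =>
      have : val (b :: σ) = b.toNat + 2 * val σ := rfl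
      rw [this, List.length_cons, pow_succ]
      have := b.toNat_le
      omega
  have h2 := bits_val (bits n v)
  rw [length_bits] at h2
  have h3 := h1 (bits n v)
  rw [length_bits] at h3
  refine (seg_testBit h3).symm.trans (Eq.trans ?_ (seg_testBit h))
  rw [seg_eq_iff]
  intro i hi
  have h4 := congrArg (fun l => l[i]?) h2
  simpa [bits, hi] using h4

theorem primrec_bits : Primrec fun p : ℕ × ℕ => bits p.1 p.2 := by
  refine Primrec.list_map (Primrec.list_range.comp Primrec.fst) ?_
  have : Primrec fun q : (ℕ × ℕ) × ℕ => q.1.2.testBit q.2 := by fun_prop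
  exact this

theorem primrec_val : Primrec val := by
  refine Primrec.list_foldr (f := fun σ : List Bool => σ) (g := fun _ => 0)
    (h := fun _ p => p.1.toNat + 2 * p.2) Primrec.id (Primrec.const 0) ?_
  have h : Primrec Bool.toNat := Primrec.dom_bool _
  have : Primrec fun q : List Bool × Bool × ℕ => q.2.1.toNat + 2 * q.2.2 := by fun_prop
  exact this

theorem mem_Cyl_iff {W : Set (List Bool)} {X : ℕ → Bool} :
    X ∈ Cyl W ↔ ∃ n, bits n (seg X n) ∈ W := by
  have key : ∀ (σ : List Bool), (∀ i : Fin σ.length, X i = σ.get i) ↔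
      bits σ.length (seg X σ.length) = σ := by
    intro σ
    rw [bits, List.ext_get_iff]
    simp only [List.length_map, List.length_range, true_and]
    constructor
    · intro h i h1 h2
      simpa [testBit_seg X h2] using h ⟨i, h2⟩
    · intro h i
      have := h i (by simp) i.2
      simpa [testBit_seg X i.2] using this
  constructor
  · rintro ⟨σ, hσ, h⟩
    exact ⟨σ.length, by rwa [(key σ).1 h]⟩
  · rintro ⟨n, hn⟩
    refine ⟨_, hn, (key _).2 ?_⟩
    rw [length_bits]

open Classical in
/-- The characteristic sequence of a set. -/
noncomputable def bit (A : Set ℕ) (i : ℕ) : Bool := decide (i ∈ A)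

theorem chi_eq (A : Set ℕ) (i : ℕ) : chi A i = (bit A i).toNat := by
  by_cases h : i ∈ A <;> simp [chi, bit, h]

theorem exists_evaln {f : ℕ →. ℕ} (hf : Nat.Partrec f) :
    ∃ c : Nat.Partrec.Code, ∀ x, (f x).Dom ↔ ∃ k, (c.evaln k x).isSome := by
  obtain ⟨c, rfl⟩ := Nat.Partrec.Code.exists_code.1 hf
  refine ⟨c, fun x => ?_⟩
  simp only [Part.dom_iff_mem, Nat.Partrec.Code.evaln_complete, Option.isSome_iff_exists,
    Option.mem_def]
  exact exists_comm

theorem primrecPred_evaln {α : Type*} [Primcodable α] {k x : α → ℕ} {c : α → Nat.Partrec.Code}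
    (hk : Primrec k) (hc : Primrec c) (hx : Primrec x) :
    PrimrecPred fun a => ((c a).evaln (k a) (x a)).isSome = true :=
  primrecPred_eq' (Primrec.option_isSome.comp
    (Nat.Partrec.Code.primrec_evaln.comp ((hk.pair hc).pair hx))) (Primrec.const true)

/-- The finite partial oracle given by the first `p.1` binary digits of `p.2`. -/
def table (p : ℕ × ℕ) (i : ℕ) : Part ℕ :=
  ((if i < p.1 then some (p.2.testBit i).toNat else none : Option ℕ) : Part ℕ)

theorem partrec_table : Partrec₂ table := by
  have h0 : Primrec Bool.toNat := Primrec.dom_bool _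
  have h : Primrec fun q : (ℕ × ℕ) × ℕ =>
      (if q.2 < q.1.1 then some (q.1.2.testBit q.2).toNat else none : Option ℕ) := by
    refine Primrec.ite (by fun_prop) ?_ (Primrec.const none)
    exact Primrec.option_some.comp (by fun_prop)
  exact h.to_comp.ofOption

theorem mem_table {m v i y : ℕ} :
    y ∈ table (m, v) i ↔ i < m ∧ y = (v.testBit i).toNat := by
  unfold table
  split_ifs with h <;> simp [h]

theorem exists_rel_of_oracleCode (c : OracleCode) : ∃ R : ℕ × ℕ × ℕ → Prop, PrimrecPred R ∧
    ∀ A x, (c.eval (chi A) x).Dom ↔ ∃ s, R (s, seg (bit A) s, x) := by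
  have h1 : Partrec fun z : ℕ => c.peval (table (z.unpair.1, z.unpair.2.unpair.1))
      z.unpair.2.unpair.2 := by
    refine (OracleCode.partrec_peval partrec_table c).comp ?_ ?_
    · exact Primrec.to_comp (by fun_prop)
    · exact Primrec.to_comp (by fun_prop)
  obtain ⟨d, hd⟩ := exists_evaln (Partrec.nat_iff.1 h1)
  refine ⟨fun p => (d.evaln p.1.unpair.1 (Nat.pair p.1.unpair.2
      (Nat.pair (p.2.1 % 2 ^ p.1.unpair.2) p.2.2))).isSome, ?_, fun A x => ?_⟩
  · exact primrecPred_evaln (by fun_prop) (by fun_prop) (by fun_prop)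
  have h2 : (∃ s, (d.evaln s.unpair.1 (Nat.pair s.unpair.2
      (Nat.pair (seg (bit A) s % 2 ^ s.unpair.2) x))).isSome) ↔
      ∃ m, (c.peval (table (m, seg (bit A) m)) x).Dom := by
    have : ∀ m, (c.peval (table (m, seg (bit A) m)) x).Dom ↔ _ := fun m => by
      simpa using hd (Nat.pair m (Nat.pair (seg (bit A) m) x))
    simp only [this]
    constructor
    · rintro ⟨s, hs⟩
      exact ⟨s.unpair.2, s.unpair.1, by rwa [seg_mod _ s.unpair_right_le] at hs⟩
    · rintro ⟨m, k, hk⟩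
      refine ⟨Nat.pair k m, ?_⟩
      rw [seg_mod _ (Nat.unpair_right_le _)]
      simpa using hk
  rw [h2, ← OracleCode.peval_coe]
  have h3 : ∀ m i y, y ∈ table (m, seg (bit A) m) i ↔ i < m ∧ y = chi A i := by
    intro m i y
    rw [mem_table, chi_eq]
    exact and_congr_right fun h => by rw [testBit_seg _ h]
  constructor
  · intro h
    obtain ⟨y, hy⟩ := Part.dom_iff_mem.1 h
    obtain ⟨m, hm⟩ := OracleCode.exists_peval (T := fun m => table (m, seg (bit A) m))
      (fun m n hmn i y hy => by
        rw [h3] at hy ⊢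
        exact ⟨by omega, hy.2⟩)
      (fun i y hy => ⟨i + 1, (h3 _ _ _).2 ⟨by omega, Part.mem_some_iff.1 hy⟩⟩) c x y hy
    exact ⟨m, Part.dom_iff_mem.2 ⟨y, hm⟩⟩
  · rintro ⟨m, h⟩
    obtain ⟨y, hy⟩ := Part.dom_iff_mem.1 h
    refine Part.dom_iff_mem.2 ⟨y, OracleCode.peval_mono (fun i y hy => ?_) c x y hy⟩
    exact Part.mem_some_iff.2 ((h3 _ _ _).1 hy).2

theorem exists_oracleCode_of_primrec {f : ℕ → ℕ} (hf : Primrec f) :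
    ∃ c : OracleCode, ∀ O x, c.eval O x = Part.some (f x) := by
  obtain ⟨c, hc⟩ := exists_oracleCode (Nat.Partrec.of_primrec (Primrec.nat_iff.1 hf))
  exact ⟨c, fun O x => by rw [hc]; rfl⟩

namespace OracleCode

variable {O : ℕ → ℕ} {cf cg : OracleCode}

theorem eval_comp_of_eq {x a : ℕ} (h : cg.eval O x = Part.some a) :
    (comp cf cg).eval O x = cf.eval O a := by
  change (cg.eval O x).bind (fun y => cf.eval O y) = _
  rw [h]
  exact Part.bind_some _ _

theorem eval_pair_of_eq {x a b : ℕ} (hf : cf.eval O x = Part.some a)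
    (hg : cg.eval O x = Part.some b) :
    (pair cf cg).eval O x = Part.some (Nat.pair a b) := by
  have : (pair cf cg).eval O x = Nat.pair <$> cf.eval O x <*> cg.eval O x := rfl
  rw [this, hf, hg]
  simp [Seq.seq]

theorem eval_left (x : ℕ) : left.eval O x = Part.some x.unpair.1 := rfl

theorem eval_right (x : ℕ) : right.eval O x = Part.some x.unpair.2 := rfl

theorem eval_prec_zero (a : ℕ) : (prec cf cg).eval O (Nat.pair a 0) = cf.eval O a := by
  simp only [eval, Nat.unpaired, Nat.unpair_pair]
  rfl

theorem eval_prec_succ {a n i : ℕ} (h : (prec cf cg).eval O (Nat.pair a n) = Part.some i) :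
    (prec cf cg).eval O (Nat.pair a (n + 1)) = cg.eval O (Nat.pair a (Nat.pair n i)) := by
  simp only [eval, Nat.unpaired, Nat.unpair_pair] at h ⊢
  rw [h]
  exact Part.bind_some _ _

end OracleCode

theorem exists_oracleCode_seg :
    ∃ c : OracleCode, ∀ A a s, c.eval (chi A) (Nat.pair a s) = Part.some (seg (bit A) s) := by
  obtain ⟨q, hq⟩ := exists_oracleCode_of_primrec (f := fun z =>
    z.unpair.2.unpair.2.unpair.2 + z.unpair.1 * 2 ^ z.unpair.2.unpair.2.unpair.1) (by fun_prop)
  refine ⟨.prec .zero (.comp q (.pair (.comp .oracle (.comp .left .right))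
    (.pair .left .right))), fun A a s => ?_⟩
  induction s with
  | zero => rw [OracleCode.eval_prec_zero]; rfl
  | succ s ih =>
    rw [OracleCode.eval_prec_succ ih, OracleCode.eval_comp_of_eq (OracleCode.eval_pair_of_eq
      ((OracleCode.eval_comp_of_eq (OracleCode.eval_comp_of_eq (OracleCode.eval_right _))).trans
        rfl) (OracleCode.eval_pair_of_eq (OracleCode.eval_left _) (OracleCode.eval_right _))), hq]
    simp [seg, chi_eq]

open Classical in
theorem exists_oracleCode_of_rel {R : ℕ × ℕ × ℕ → Prop} (hR : PrimrecPred R) :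
    ∃ c : OracleCode, ∀ A x, (c.eval (chi A) x).Dom ↔ ∃ s, R (s, seg (bit A) s, x) := by
  obtain ⟨h, hh⟩ := exists_oracleCode_seg
  obtain ⟨g, hg⟩ := exists_oracleCode_of_primrec (f := fun z =>
    if R (z.unpair.2.unpair.2, z.unpair.1, z.unpair.2.unpair.1) then 0 else 1)
    (Primrec.ite (by fun_prop) (Primrec.const 0) (Primrec.const 1))
  set cf : OracleCode := .comp g (.pair h (.pair .left .right))
  have hcf : ∀ A a s, cf.eval (chi A) (Nat.pair a s) =
      Part.some (if R (s, seg (bit A) s, a) then 0 else 1) := by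
    intro A a s
    rw [OracleCode.eval_comp_of_eq (OracleCode.eval_pair_of_eq (hh A a s)
      (OracleCode.eval_pair_of_eq (OracleCode.eval_left _) (OracleCode.eval_right _))), hg]
    simp
  refine ⟨.comp (.rfind' cf) (.pair (.pair .left .right) .zero), fun A x => ?_⟩
  have h2 : (OracleCode.eval (chi A) (.comp (.rfind' cf) (.pair (.pair .left .right) .zero)) x) =
      (OracleCode.eval (chi A) (.rfind' cf) (Nat.pair x 0)) := by
    rw [OracleCode.eval_comp_of_eq (OracleCode.eval_pair_of_eq (OracleCode.eval_pair_of_eq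
      (OracleCode.eval_left _) (OracleCode.eval_right _)) (b := 0) rfl), Nat.pair_unpair]
  have h3 := fun y => OracleCode.mem_peval_rfind' (T := fun n => Part.some (chi A n)) (cf := cf)
    (x := Nat.pair x 0) (y := y)
  simp only [OracleCode.peval_coe, Nat.unpair_pair, add_zero, hcf, Part.mem_some_iff] at h3
  simp only [h2, Part.dom_iff_mem, h3]
  constructor
  · rintro ⟨y, n, ⟨hn, -⟩, -⟩
    refine ⟨n, ?_⟩
    by_contra hc
    simp [hc] at hn
  · intro hs
    refine ⟨_, Nat.find hs, ⟨?_, fun k hk => ⟨_, rfl, ?_⟩⟩, rfl⟩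
    · simp [Nat.find_spec hs]
    · simp [Nat.find_min hs hk]

/-- `R` represents the sequence `U` of effectively open classes relative to `a`. -/
def Rep (a : ℕ → Bool) (U : ℕ → Set (ℕ → Bool)) (R : ℕ × ℕ × ℕ × ℕ → Prop) : Prop :=
  PrimrecPred R ∧ ∀ n X, X ∈ U n ↔ ∃ s, R (s, seg a s, n, seg X s)

theorem CeSeqIn.exists_rep {A : Set ℕ} {W : ℕ → Set (List Bool)} (h : CeSeqIn A W) :
    ∃ R, Rep (bit A) (fun n => Cyl (W n)) R := by
  obtain ⟨c, hc⟩ := h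
  obtain ⟨R, hR, hRc⟩ := exists_rel_of_oracleCode c
  refine ⟨fun p => R (p.1.unpair.1, p.2.1 % 2 ^ p.1.unpair.1, Nat.pair p.2.2.1
    (Encodable.encode (bits p.1.unpair.2 (p.2.2.2 % 2 ^ p.1.unpair.2)))), ?_, fun n X => ?_⟩
  · have := primrec_bits
    have : Primrec fun p : ℕ × ℕ × ℕ × ℕ => bits p.1.unpair.2 (p.2.2.2 % 2 ^ p.1.unpair.2) :=
      primrec_bits.comp (by fun_prop :
        Primrec fun p : ℕ × ℕ × ℕ × ℕ => (p.1.unpair.2, p.2.2.2 % 2 ^ p.1.unpair.2))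
    fun_prop
  simp only [mem_Cyl_iff, hc, hRc]
  constructor
  · rintro ⟨l, s, h⟩
    refine ⟨Nat.pair s l, ?_⟩
    rw [seg_mod _ (Nat.unpair_left_le _), seg_mod _ (Nat.unpair_right_le _)]
    simpa using h
  · rintro ⟨s, h⟩
    rw [seg_mod _ (Nat.unpair_left_le _), seg_mod _ (Nat.unpair_right_le _)] at h
    exact ⟨_, _, h⟩

theorem Rep.exists_ceSeqIn {A : Set ℕ} {U : ℕ → Set (ℕ → Bool)} {R : ℕ × ℕ × ℕ × ℕ → Prop}
    (h : Rep (bit A) U R) : ∃ W, CeSeqIn A W ∧ ∀ n, U n = Cyl (W n) := by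
  obtain ⟨hR, hU⟩ := h
  refine ⟨fun n => {σ | R (σ.length, seg (bit A) σ.length, n, val σ)}, ?_, fun n => ?_⟩
  · obtain ⟨c, hc⟩ := exists_oracleCode_of_rel (R := fun p : ℕ × ℕ × ℕ =>
      ∃ σ : List Bool, σ = (Encodable.decode (α := List Bool) p.2.2.unpair.2).getD [] ∧
        σ.length ≤ p.1 ∧ R (σ.length, p.2.1 % 2 ^ σ.length, p.2.2.unpair.1, val σ)) (by
        have h1 : Primrec fun p : ℕ × ℕ × ℕ =>
            (Encodable.decode (α := List Bool) p.2.2.unpair.2).getD [] :=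
          Primrec.option_getD.comp (Primrec.decode.comp (by fun_prop)) (Primrec.const [])
        have h2 := Primrec.list_length.comp h1
        have h3 := primrec_val.comp h1
        simp only [exists_eq_left]
        fun_prop)
    refine ⟨c, fun n σ => ?_⟩
    rw [hc]
    simp only [Nat.unpair_pair, Encodable.encodek, Option.getD_some, exists_eq_left,
      Set.mem_ofPred_eq]
    constructor
    · exact fun h => ⟨σ.length, le_rfl, by rwa [seg_mod _ le_rfl]⟩
    · rintro ⟨s, hs, h⟩
      rwa [seg_mod _ hs] at h
  · ext X
    rw [hU, mem_Cyl_iff]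
    simp only [Set.mem_ofPred_eq, length_bits, val_bits (seg_lt _ _)]

/-- `R` is monotone along initial segments relative to `a`. -/
def MonoRep (a : ℕ → Bool) (R : ℕ × ℕ × ℕ × ℕ → Prop) : Prop :=
  ∀ n X s t, s ≤ t → R (s, seg a s, n, seg X s) → R (t, seg a t, n, seg X t)

theorem Rep.exists_mono {a : ℕ → Bool} {U : ℕ → Set (ℕ → Bool)} {R : ℕ × ℕ × ℕ × ℕ → Prop}
    (h : Rep a U R) : ∃ R', Rep a U R' ∧ MonoRep a R' := by
  obtain ⟨hR, hU⟩ := h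
  have key : ∀ s n X, (∃ t < s + 1, R (t, seg a s % 2 ^ t, n, seg X s % 2 ^ t)) ↔
      ∃ t ≤ s, R (t, seg a t, n, seg X t) := by
    intro s n X
    simp only [Nat.lt_succ_iff]
    exact exists_congr fun t => and_congr_right fun h => by rw [seg_mod _ h, seg_mod _ h]
  refine ⟨fun p => ∃ t < p.1 + 1, R (t, p.2.1 % 2 ^ t, p.2.2.1, p.2.2.2 % 2 ^ t), ⟨?_, ?_⟩, ?_⟩
  · exact PrimrecPred.exists_lt' (by fun_prop) (by fun_prop)
  · intro n X
    simp only [key, hU]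
    exact ⟨fun ⟨s, h⟩ => ⟨s, s, le_rfl, h⟩, fun ⟨_, t, _, h⟩ => ⟨t, h⟩⟩
  · intro n X s t hst
    simp only [key]
    exact fun ⟨k, hk, h⟩ => ⟨k, hk.trans hst, h⟩

theorem seg_bit_empty (s : ℕ) : seg (bit ∅) s = 0 := by
  induction s with
  | zero => rfl
  | succ s ih => simp [seg, ih, bit]

section

open scoped ENNReal

section Measure

/-- The binary expansion of a real number. -/
noncomputable def binExp (x : ℝ) (n : ℕ) : Bool := decide (⌊x * 2 ^ (n + 1)⌋₊ % 2 = 1)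

theorem measurable_binExp : Measurable binExp := by
  refine measurable_pi_lambda _ fun n => ?_
  have : Measurable fun m : ℕ => decide (m % 2 = 1) := measurable_from_top
  exact this.comp (Nat.measurable_floor.comp (measurable_id.mul_const _))

theorem mu_eq_map : mu = Measure.map binExp (volume.restrict (Set.Ico (0 : ℝ) 1)) := rfl

instance : IsProbabilityMeasure mu := by
  rw [mu_eq_map]
  have : IsProbabilityMeasure (volume.restrict (Set.Ico (0 : ℝ) 1)) := ⟨by simp⟩
  exact Measure.isProbabilityMeasure_map measurable_binExp.aemeasurable

theorem measurable_seg (n : ℕ) : Measurable fun X : ℕ → Bool => seg X n := by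
  induction n with
  | zero => exact measurable_const
  | succ n ih =>
    have : Measurable Bool.toNat := measurable_from_top
    exact ih.add ((this.comp (measurable_pi_apply n)).mul_const _)

theorem measurableSet_seg (n : ℕ) (P : ℕ → Prop) :
    MeasurableSet {X : ℕ → Bool | P (seg X n)} :=
  measurable_seg n (MeasurableSet.of_discrete (s := {v | P v}))

theorem exists_floor_eq_of_seg_eq (n v : ℕ) (hv : v < 2 ^ n) :
    ∃ k < 2 ^ n, ∀ x ∈ Set.Ico (0 : ℝ) 1, seg (binExp x) n = v ↔ ⌊x * 2 ^ n⌋₊ = k := by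
  induction n generalizing v with
  | zero =>
    refine ⟨0, by simp, fun x hx => ?_⟩
    have : v = 0 := by simpa using hv
    simp [seg, this, hx.2]
  | succ n ih =>
    obtain ⟨k, hk, h⟩ := ih (v % 2 ^ n) (Nat.mod_lt _ (by positivity))
    have hb : v / 2 ^ n < 2 := by
      rw [Nat.div_lt_iff_lt_mul (by positivity)]; rw [pow_succ] at hv; omega
    refine ⟨2 * k + v / 2 ^ n, by rw [pow_succ]; omega, fun x hx => ?_⟩
    have h1 : ⌊x * 2 ^ n⌋₊ = ⌊x * 2 ^ (n + 1)⌋₊ / 2 := by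
      rw [← Nat.floor_div_ofNat]
      congr 1
      rw [pow_succ]; ring
    have h2 := h x hx
    have h3 : seg (binExp x) (n + 1) = v ↔
        seg (binExp x) n = v % 2 ^ n ∧ (binExp x n).toNat = v / 2 ^ n := by
      have h4 := Nat.mod_add_div v (2 ^ n)
      have h5 := seg_lt (binExp x) n
      rw [seg]
      constructor
      · intro e
        rw [← e]
        rw [Nat.add_mul_mod_self_right, Nat.mod_eq_of_lt h5,
          Nat.add_mul_div_right _ _ (by positivity), Nat.div_eq_of_lt h5]
        simp
      · rintro ⟨e1, e2⟩
        rw [e1, e2]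
        linarith [mul_comm (2 ^ n) (v / 2 ^ n)]
    have h6 : (binExp x n).toNat = ⌊x * 2 ^ (n + 1)⌋₊ % 2 := by
      unfold binExp
      rcases Nat.mod_two_eq_zero_or_one ⌊x * 2 ^ (n + 1)⌋₊ with h | h <;> simp [h]
    rw [h3, h2, h1, h6]
    clear h3 h6 h2 h
    generalize v / 2 ^ n = q at *
    omega

theorem mu_seg_eq {n v : ℕ} (hv : v < 2 ^ n) :
    mu {X | seg X n = v} = 2⁻¹ ^ n := by
  obtain ⟨k, hk, h⟩ := exists_floor_eq_of_seg_eq n v hv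
  rw [mu_eq_map, Measure.map_apply measurable_binExp (measurableSet_seg n (· = v)),
    Measure.restrict_apply (measurable_binExp (measurableSet_seg n (· = v)))]
  have hp : (0 : ℝ) < 2 ^ n := by positivity
  have : binExp ⁻¹' {X | seg X n = v} ∩ Set.Ico (0 : ℝ) 1 =
      Set.Ico ((k : ℝ) / 2 ^ n) ((k + 1) / 2 ^ n) := by
    ext x
    simp only [Set.mem_inter_iff, Set.mem_preimage, Set.mem_ofPred_eq]
    have hkr : (k : ℝ) + 1 ≤ 2 ^ n := by exact_mod_cast hk
    constructor
    · rintro ⟨h1, hx⟩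
      rw [h x hx, Nat.floor_eq_iff (by have := hx.1; positivity)] at h1
      rw [Set.mem_Ico, div_le_iff₀ hp, lt_div_iff₀ hp]
      exact h1
    · intro hx
      rw [Set.mem_Ico, div_le_iff₀ hp, lt_div_iff₀ hp] at hx
      have hx' : x ∈ Set.Ico (0 : ℝ) 1 := by
        constructor
        · by_contra hc
          have : x * 2 ^ n < 0 := mul_neg_of_neg_of_pos (not_le.1 hc) hp
          have : (0 : ℝ) ≤ k := by positivity
          linarith
        · by_contra hc
          have : 1 * 2 ^ n ≤ x * 2 ^ n := by gcongr; exact not_lt.1 hc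
          linarith
      refine ⟨(h x hx').2 ?_, hx'⟩
      rw [Nat.floor_eq_iff (by have := hx'.1; positivity)]
      exact hx
  rw [this, Real.volume_Ico, ← sub_div, add_sub_cancel_left,
    ENNReal.ofReal_div_of_pos hp, ENNReal.ofReal_pow (by norm_num)]
  simp [ENNReal.inv_pow]

open Classical in
theorem mu_seg_mem (n : ℕ) (P : ℕ → Prop) :
    mu {X | P (seg X n)} = ((Finset.range (2 ^ n)).filter P).card * 2⁻¹ ^ n := by
  have : {X | P (seg X n)} =
      ⋃ v ∈ (Finset.range (2 ^ n)).filter P, {X : ℕ → Bool | seg X n = v} := by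
    ext X
    simp [seg_lt]
  rw [this, measure_biUnion_finset]
  · rw [Finset.sum_congr rfl fun v hv => mu_seg_eq (n := n) (v := v) ?_]
    · simp
    · simpa using (Finset.mem_filter.1 hv).1
  · intro v _ w _ hvw
    refine Set.disjoint_left.2 fun X hX hX' => hvw ?_
    exact hX.symm.trans hX'
  · exact fun v _ => measurableSet_seg n (· = v)

open Classical in
theorem mu_real_seg_mem (n : ℕ) (P : ℕ → Prop) :
    mu.real {X | P (seg X n)} = ((Finset.range (2 ^ n)).filter P).card / 2 ^ n := by
  rw [Measure.real, mu_seg_mem]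
  simp [div_eq_mul_inv]

theorem card_filter_testBit {n : ℕ} {B : Finset ℕ} (hB : B ⊆ Finset.range n) :
    ((Finset.range (2 ^ n)).filter fun v => ∀ m ∈ B, v.testBit m = false).card =
      2 ^ (n - B.card) := by
  have h := Finset.card_sdiff_of_subset hB
  rw [Finset.card_range] at h
  rw [← h, ← Finset.card_powerset]
  refine Finset.card_nbij' (fun v => (Finset.range n \ B).filter fun m => v.testBit m = true)
    (fun s => seg (fun m => decide (m ∈ s)) n) ?_ ?_ ?_ ?_
  · intro v _
    exact Finset.mem_coe.2 (Finset.mem_powerset.2 (Finset.filter_subset _ _))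
  · intro s hs
    simp only [Finset.coe_powerset, Set.mem_preimage, Set.mem_powerset_iff, Finset.coe_subset] at hs
    simp only [Finset.coe_filter, Finset.mem_range, Set.mem_ofPred_eq]
    refine ⟨seg_lt _ _, fun m hm => ?_⟩
    rw [testBit_seg _ (Finset.mem_range.1 (hB hm))]
    simp only [decide_eq_false_iff_not]
    intro h
    exact (Finset.mem_sdiff.1 (hs h)).2 hm
  · intro v hv
    simp only [Finset.coe_filter, Finset.mem_range, Set.mem_ofPred_eq] at hv
    conv_rhs => rw [← seg_testBit hv.1]
    rw [seg_eq_iff]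
    intro i hi
    by_cases hiB : i ∈ B
    · simp [hiB, hv.2 i hiB]
    · simp [hiB, hi]
  · intro s hs
    simp only [Finset.coe_powerset, Set.mem_preimage, Set.mem_powerset_iff, Finset.coe_subset] at hs
    ext m
    simp only [Finset.mem_filter]
    constructor
    · rintro ⟨h1, h2⟩
      rw [testBit_seg _ (Finset.mem_range.1 (Finset.mem_sdiff.1 h1).1)] at h2
      simpa using h2
    · intro h
      refine ⟨hs h, ?_⟩
      rw [testBit_seg _ (Finset.mem_range.1 (Finset.mem_sdiff.1 (hs h)).1)]
      simpa using h

/-- The set of sequences vanishing on `B`. -/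
def vanish (B : Finset ℕ) : Set (ℕ → Bool) := {X | ∀ m ∈ B, X m = false}

theorem vanish_eq {B : Finset ℕ} {n : ℕ} (h : B ⊆ Finset.range n) :
    vanish B = {X | (fun v : ℕ => ∀ m ∈ B, v.testBit m = false) (seg X n)} := by
  ext X
  exact forall₂_congr fun m hm => by rw [testBit_seg _ (Finset.mem_range.1 (h hm))]

theorem measurableSet_vanish (B : Finset ℕ) : MeasurableSet (vanish B) := by
  obtain ⟨n, hn⟩ := B.exists_nat_subset_range
  rw [vanish_eq hn]
  exact measurableSet_seg n (fun v => ∀ m ∈ B, v.testBit m = false)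

theorem mu_vanish (B : Finset ℕ) : mu.real (vanish B) = 2⁻¹ ^ B.card := by
  obtain ⟨n, hn⟩ := B.exists_nat_subset_range
  rw [vanish_eq hn, mu_real_seg_mem n (fun v => ∀ m ∈ B, v.testBit m = false)]
  have h1 := card_filter_testBit hn
  have h2 : B.card ≤ n := by simpa using Finset.card_le_card hn
  have h3 : (2 : ℝ) ^ n = 2 ^ (n - B.card) * 2 ^ B.card := by
    rw [← pow_add, Nat.sub_add_cancel h2]
  rw [h3, inv_pow]
  convert_to ((2 ^ (n - B.card) : ℕ) : ℝ) / (2 ^ (n - B.card) * 2 ^ B.card) = _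
  · rw [← h1]
    congr!
  · push_cast
    field_simp

theorem mu_iInter_compl_vanish {ι : Type*} [DecidableEq ι] (F : Finset ι) (b : ι → Finset ℕ)
    (hb : ∀ x y, x ≠ y → Disjoint (b x) (b y)) (B : Finset ℕ) (hB : ∀ x ∈ F, Disjoint (b x) B) :
    mu.real ((⋂ x ∈ F, (vanish (b x))ᶜ) ∩ vanish B) =
      (∏ x ∈ F, (1 - 2⁻¹ ^ (b x).card)) * 2⁻¹ ^ B.card := by
  induction F using Finset.induction_on generalizing B with
  | empty => simp [mu_vanish]
  | insert y F hy ih =>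
    have h1 := ih B fun x hx => hB x (Finset.mem_insert_of_mem hx)
    have h2 := ih (b y ∪ B) fun x hx => by
      rw [Finset.disjoint_union_right]
      exact ⟨hb _ _ (by rintro rfl; exact hy hx), hB x (Finset.mem_insert_of_mem hx)⟩
    rw [Finset.card_union_of_disjoint (hB y (Finset.mem_insert_self _ _))] at h2
    have h3 : (⋂ x ∈ insert y F, (vanish (b x))ᶜ) ∩ vanish B =
        ((⋂ x ∈ F, (vanish (b x))ᶜ) ∩ vanish B) \
        ((⋂ x ∈ F, (vanish (b x))ᶜ) ∩ vanish (b y ∪ B)) := by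
      have : vanish (b y ∪ B) = vanish (b y) ∩ vanish B := by
        ext X
        simp only [vanish, Finset.mem_union, Set.mem_ofPred_eq, Set.mem_inter_iff]
        exact ⟨fun h => ⟨fun m hm => h m (.inl hm), fun m hm => h m (.inr hm)⟩,
          fun h m hm => hm.elim (h.1 m) (h.2 m)⟩
      rw [this, Finset.set_biInter_insert]
      ext X
      simp only [Set.mem_inter_iff, Set.mem_sdiff, Set.mem_compl_iff]
      tauto
    rw [h3, measureReal_sdiff _ _, h1, h2, Finset.prod_insert hy]
    · ring
    · rintro X ⟨hX, hX'⟩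
      exact ⟨hX, fun m hm => hX' m (Finset.mem_union_right _ hm)⟩
    · exact (Finset.measurableSet_biInter _ fun x _ => (measurableSet_vanish _).compl).inter
        (measurableSet_vanish _)

end Measure

section Weight

theorem tsum_le_tsum_of_exists {ι κ α : Type*} {w : ι → ℝ≥0∞} {u : κ → ℝ≥0∞} (p : κ → α)
    {q : ι → α} (hq : Function.Injective q) (h : ∀ i, ∃ j, p j = q i ∧ w i ≤ u j) :
    ∑' i, w i ≤ ∑' j, u j := by
  choose f hf hw using h
  have hinj : Function.Injective f := fun i j hij => hq (by rw [← hf, ← hf, hij])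
  exact (ENNReal.tsum_le_tsum hw).trans (ENNReal.tsum_comp_le_tsum_of_injective hinj u)

/-- The weight of a set of pairs `(i, k)`, where the pair `(i, k)` weighs `2⁻ᵏ`. -/
noncomputable def wt (S : Set ℕ) : ℝ≥0∞ := ∑' x : S, 2⁻¹ ^ (x : ℕ).unpair.2

theorem wt_le_of_exists {κ α : Type*} {S : Set ℕ} {u : κ → ℝ≥0∞} (p : κ → α) (q : ℕ → α)
    (hq : Set.InjOn q S) (h : ∀ x ∈ S, ∃ j, p j = q x ∧ 2⁻¹ ^ x.unpair.2 ≤ u j) :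
    wt S ≤ ∑' j, u j :=
  tsum_le_tsum_of_exists p (q := fun x : S => q x)
    (fun x y hxy => Subtype.ext (hq x.2 y.2 hxy)) fun x => h x x.2

theorem wt_mono {S T : Set ℕ} (h : S ⊆ T) : wt S ≤ wt T :=
  wt_le_of_exists (fun y : T => (y : ℕ)) id Function.injective_id.injOn
    fun x hx => ⟨⟨x, h hx⟩, rfl, le_rfl⟩

theorem wt_le_of_forall_finset {S : Set ℕ} {b : ℝ≥0∞}
    (h : ∀ F : Finset ℕ, ↑F ⊆ S → ∑ x ∈ F, 2⁻¹ ^ x.unpair.2 ≤ b) : wt S ≤ b := by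
  rw [wt, ENNReal.tsum_eq_iSup_sum]
  refine iSup_le fun F => ?_
  have := h (F.map (Function.Embedding.subtype _)) (by intro x; simp; exact fun h _ => h)
  simpa using this

theorem sum_le_wt {S : Set ℕ} {F : Finset ℕ} (h : ↑F ⊆ S) :
    ∑ x ∈ F, (2⁻¹ : ℝ≥0∞) ^ x.unpair.2 ≤ wt S := by
  refine le_trans ?_ (wt_mono h)
  rw [wt]
  exact (Finset.tsum_subtype' F (fun x : ℕ => (2⁻¹ : ℝ≥0∞) ^ x.unpair.2)).ge

theorem sum_two_pow_sub {F : Finset ℕ} {s : ℕ} (h : ∀ y ∈ F, y.unpair.2 ≤ s) :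
    ((∑ y ∈ F, 2 ^ (s - y.unpair.2) : ℕ) : ℝ≥0∞) =
      (∑ y ∈ F, 2⁻¹ ^ y.unpair.2) * 2 ^ s := by
  push_cast
  rw [Finset.sum_mul]
  refine Finset.sum_congr rfl fun y hy => ?_
  obtain ⟨d, hd⟩ := Nat.exists_eq_add_of_le (h y hy)
  rw [hd, Nat.add_sub_cancel_left, pow_add, ← mul_assoc, ← mul_pow,
    ENNReal.inv_mul_cancel (by simp) (by simp), one_pow, one_mul]

theorem sum_two_pow_sub_le {F : Finset ℕ} {s : ℕ} (h : ∀ y ∈ F, y.unpair.2 ≤ s) :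
    (∑ y ∈ F, 2 ^ (s - y.unpair.2)) ≤ 2 ^ s ↔
      ∑ y ∈ F, (2⁻¹ : ℝ≥0∞) ^ y.unpair.2 ≤ 1 := by
  rw [← Nat.cast_le (α := ℝ≥0∞), sum_two_pow_sub h]
  push_cast
  have h0 : (2 ^ s : ℝ≥0∞) ≠ 0 := by simp
  have h1 : (2 ^ s : ℝ≥0∞) ≠ ∞ := by simp
  have h2 : ∀ a : ℝ≥0∞, a * 2 ^ s ≤ 1 * 2 ^ s ↔ a ≤ 1 := fun a =>
    ENNReal.mul_le_mul_iff_left h0 h1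
  rw [← h2, one_mul]

/-- Effectively enumerable sets. -/
def Ce (S : Set ℕ) : Prop :=
  ∃ R : ℕ × ℕ → Prop, PrimrecPred R ∧ ∀ x, x ∈ S ↔ ∃ s, R (s, x)

theorem Ce.exists_mono {S : Set ℕ} (h : Ce S) : ∃ R : ℕ × ℕ → Prop, PrimrecPred R ∧
    (∀ x, x ∈ S ↔ ∃ s, R (s, x)) ∧ ∀ x s t, s ≤ t → R (s, x) → R (t, x) := by
  obtain ⟨R, hR, hS⟩ := h
  refine ⟨fun p => ∃ t < p.1 + 1, R (t, p.2), ?_, fun x => ?_, ?_⟩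
  · exact PrimrecPred.exists_lt' (by fun_prop) (by fun_prop)
  · rw [hS]
    exact ⟨fun ⟨s, h⟩ => ⟨s, s, by simp, h⟩, fun ⟨_, t, _, h⟩ => ⟨t, h⟩⟩
  · rintro x s t hst ⟨k, hk, h⟩
    exact ⟨k, by simp only at hk ⊢; omega, h⟩

theorem Ce.preimage {S : Set ℕ} (h : Ce S) {f : ℕ → ℕ} (hf : Primrec f) {P : ℕ → Prop}
    (hP : PrimrecPred P) : Ce {x | P x ∧ f x ∈ S} := by
  obtain ⟨R, hR, hS⟩ := h
  refine ⟨fun p => P p.2 ∧ R (p.1, f p.2), by fun_prop, fun x => ?_⟩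
  simp [hS]

open Classical in
theorem Ce.exists_code {S : Set ℕ} (h : Ce S) :
    ∃ c : Nat.Partrec.Code, ∀ x, x ∈ S ↔ ∃ k, (c.evaln k x).isSome := by
  obtain ⟨R, hR, hS⟩ := h
  have h1 : Partrec fun x => Nat.rfind fun s => Part.some (decide (R (s, x))) := by
    refine Partrec.rfind (p := fun x s => (Part.some (decide (R (s, x))) : Part Bool)) ?_
    have : Primrec fun q : ℕ × ℕ => decide (R (q.2, q.1)) :=
      (hR.comp (Primrec.snd.pair Primrec.fst)).decide
    exact this.to_comp
  obtain ⟨c, hc⟩ := exists_evaln (Partrec.nat_iff.1 h1)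
  refine ⟨c, fun x => ?_⟩
  rw [← hc, hS]
  refine Iff.symm (Nat.rfind_dom.trans (exists_congr fun s => ?_))
  constructor
  · rintro ⟨h1, -⟩
    simpa [eq_comm] using Part.mem_some_iff.1 h1
  · exact fun h1 => ⟨Part.mem_some_iff.2 (by simp [h1]), fun _ => trivial⟩

/-- `x` is enumerated by stage `s` by the code numbered `e`. -/
def Enum (e s x : ℕ) : Prop :=
  ((Denumerable.ofNat Nat.Partrec.Code e).evaln s x).isSome = true

theorem primrecPred_Enum {α : Type*} [Primcodable α] {e s x : α → ℕ}
    (he : Primrec e) (hs : Primrec s) (hx : Primrec x) :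
    PrimrecPred fun a => Enum (e a) (s a) (x a) :=
  primrecPred_evaln hs ((Primrec.ofNat _).comp he) hx

theorem Enum.mono {e s t x : ℕ} (hst : s ≤ t) (h : Enum e s x) : Enum e t x := by
  obtain ⟨y, hy⟩ := Option.isSome_iff_exists.1 h
  exact Option.isSome_iff_exists.2 ⟨y, Nat.Partrec.Code.evaln_mono hst hy⟩

theorem Enum.lt {e s x : ℕ} (h : Enum e s x) : x < s := by
  obtain ⟨y, hy⟩ := Option.isSome_iff_exists.1 h
  exact Nat.Partrec.Code.evaln_bound hy

open Classical in
/-- `x` is enumerated by stage `s` by the code numbered `e`, and the set enumerated so far has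
weight at most one. -/
def LightEnum (e s x : ℕ) : Prop :=
  Enum e s x ∧ ∑ y ∈ Finset.range s, (if Enum e s y then 2 ^ (s - y.unpair.2) else 0) ≤ 2 ^ s

open Classical in
theorem primrecPred_LightEnum {α : Type*} [Primcodable α] {e s x : α → ℕ}
    (he : Primrec e) (hs : Primrec s) (hx : Primrec x) :
    PrimrecPred fun a => LightEnum (e a) (s a) (x a) := by
  refine (primrecPred_Enum he hs hx).and ?_
  have : Primrec fun a => ∑ y ∈ Finset.range (s a),
      (if Enum (e a) (s a) y then 2 ^ (s a - y.unpair.2) else 0) := by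
    refine Primrec.sum_range (g := fun a y => if Enum (e a) (s a) y then 2 ^ (s a - y.unpair.2)
      else 0) (Primrec.ite (primrecPred_Enum ?_ ?_ ?_) ?_ ?_) hs <;> fun_prop
  fun_prop

open Classical in
theorem lightEnum_iff {e s x : ℕ} : LightEnum e s x ↔ Enum e s x ∧
    ∑ y ∈ (Finset.range s).filter (Enum e s), (2⁻¹ : ℝ≥0∞) ^ y.unpair.2 ≤ 1 := by
  rw [LightEnum, ← Finset.sum_filter, sum_two_pow_sub_le]
  intro y hy
  have := Finset.mem_range.1 (Finset.mem_filter.1 hy).1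
  have := Nat.unpair_right_le y
  omega

open Classical in
theorem wt_lightEnum_le (e : ℕ) : wt {x | ∃ s, LightEnum e s x} ≤ 1 := by
  refine wt_le_of_forall_finset fun F hF => ?_
  rcases F.eq_empty_or_nonempty with rfl | hne
  · simp
  choose! t ht using fun x (hx : x ∈ F) => hF hx
  obtain ⟨z, hz, hmax⟩ := F.exists_max_image t hne
  refine le_trans (Finset.sum_le_sum_of_subset ?_) (lightEnum_iff.1 (ht z hz)).2
  intro x hx
  have := (ht x hx).1.mono (hmax x hx)
  exact Finset.mem_filter.2 ⟨Finset.mem_range.2 this.lt, this⟩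

/-- A universal effectively enumerable set of weight at most one. -/
def univSet : Set ℕ :=
  {x | ∃ s, ∃ k < x.unpair.2, LightEnum (x.unpair.2 - k - 1) s (Nat.pair x.unpair.1 k)}

theorem ce_univSet : Ce univSet := by
  refine ⟨fun p => ∃ k < p.2.unpair.2, LightEnum (p.2.unpair.2 - k - 1) p.1
    (Nat.pair p.2.unpair.1 k), ?_, fun x => Iff.rfl⟩
  refine PrimrecPred.exists_lt' (primrecPred_LightEnum ?_ ?_ ?_) ?_ <;> fun_prop

theorem tsum_inv_two_pow_succ : ∑' e : ℕ, (2⁻¹ : ℝ≥0∞) ^ (e + 1) = 1 :=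
  ENNReal.tsum_geometric_add_one _ |>.trans (by
    rw [ENNReal.one_sub_inv_two, inv_inv]; exact ENNReal.inv_mul_cancel (by simp) (by simp))

theorem wt_univSet_le : wt univSet ≤ 1 := by
  calc wt univSet ≤ ∑' p : (Σ e : ℕ, {x | ∃ s, LightEnum e s x}),
        2⁻¹ ^ (p.1 + 1) * 2⁻¹ ^ (p.2 : ℕ).unpair.2 := by
        refine wt_le_of_exists (fun p => Nat.pair (p.2 : ℕ).unpair.1
          ((p.2 : ℕ).unpair.2 + p.1 + 1)) id Function.injective_id.injOn ?_
        rintro x ⟨s, k, hk, h⟩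
        refine ⟨⟨x.unpair.2 - k - 1, Nat.pair x.unpair.1 k, s, h⟩, ?_, ?_⟩
        · simp only [Nat.unpair_pair, id]
          rw [show k + (x.unpair.2 - k - 1) + 1 = x.unpair.2 by omega, Nat.pair_unpair]
        · simp only [Nat.unpair_pair, ← pow_add]
          rw [show x.unpair.2 - k - 1 + 1 + k = x.unpair.2 by omega]
    _ = ∑' e : ℕ, 2⁻¹ ^ (e + 1) * wt {x | ∃ s, LightEnum e s x} := by
        rw [ENNReal.tsum_sigma']
        simp only [ENNReal.tsum_mul_left, wt]
    _ ≤ ∑' e : ℕ, 2⁻¹ ^ (e + 1) * 1 := by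
        gcongr
        exact wt_lightEnum_le _
    _ = 1 := by simp only [mul_one, tsum_inv_two_pow_succ]

theorem exists_inv_two_pow_mul_le {a : ℝ≥0∞} (ha : a ≠ ∞) {b : ℝ≥0∞} (hb : b ≠ 0) :
    ∃ c : ℕ, 2⁻¹ ^ c * a ≤ b := by
  have : Tendsto (fun c : ℕ => (2⁻¹ : ℝ≥0∞) ^ c * a) atTop (nhds (0 * a)) :=
    ENNReal.Tendsto.mul_const
      (ENNReal.tendsto_pow_atTop_nhds_zero_of_lt_one ENNReal.one_half_lt_one) (.inr ha)
  rw [zero_mul] at this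
  obtain ⟨c, hc⟩ := (this.eventually (ge_mem_nhds (pos_iff_ne_zero.2 hb))).exists
  exact ⟨c, hc⟩

open Classical in
theorem Ce.exists_mem_univSet {S : Set ℕ} (h : Ce S) (hS : wt S ≠ ∞) :
    ∃ c, ∀ i k, Nat.pair i k ∈ S → Nat.pair i (k + c) ∈ univSet := by
  obtain ⟨c, hc⟩ := exists_inv_two_pow_mul_le hS one_ne_zero
  have h1 : Ce {x | c ≤ x.unpair.2 ∧ Nat.pair x.unpair.1 (x.unpair.2 - c) ∈ S} :=
    h.preimage (by fun_prop) (by fun_prop)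
  have h2 : wt {x | c ≤ x.unpair.2 ∧ Nat.pair x.unpair.1 (x.unpair.2 - c) ∈ S} ≤ 1 := by
    refine le_trans ?_ hc
    rw [wt, wt, ← ENNReal.tsum_mul_left]
    refine wt_le_of_exists (fun y : S => Nat.pair (y : ℕ).unpair.1 ((y : ℕ).unpair.2 + c)) id
      Function.injective_id.injOn ?_
    rintro x ⟨hx1, hx2⟩
    refine ⟨⟨_, hx2⟩, ?_, ?_⟩
    · simp [hx1]
    · simp [← pow_add, hx1]
  obtain ⟨e, he⟩ := h1.exists_code
  refine ⟨c + Encodable.encode e + 1, fun i k hik => ?_⟩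
  have h3 : Nat.pair i (k + c) ∈
      {x | c ≤ x.unpair.2 ∧ Nat.pair x.unpair.1 (x.unpair.2 - c) ∈ S} := by
    simp [hik]
  obtain ⟨s, hs⟩ := (he _).1 h3
  refine ⟨s, k + c, by rw [Nat.unpair_pair]; omega, ?_⟩
  have h4 : (Nat.pair i (k + (c + Encodable.encode e + 1))).unpair.2 - (k + c) - 1 =
      Encodable.encode e := by rw [Nat.unpair_pair]; omega
  rw [h4, Nat.unpair_pair]
  refine lightEnum_iff.2 ⟨by simpa [Enum] using hs, le_trans (sum_le_wt ?_) h2⟩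
  intro y hy
  have := (Finset.mem_filter.1 hy).2
  exact (he y).2 ⟨s, by simpa [Enum] using this⟩

end Weight

section New

theorem measurableSet_of_rep {a : ℕ → Bool} {U : ℕ → Set (ℕ → Bool)}
    {R : ℕ × ℕ × ℕ × ℕ → Prop} (h : Rep a U R) (n : ℕ) : MeasurableSet (U n) := by
  have : U n = ⋃ s, {X | R (s, seg a s, n, seg X s)} := by
    ext X
    simp [h.2]
  rw [this]
  exact MeasurableSet.iUnion fun s => measurableSet_seg s fun v => R (s, seg a s, n, v)

theorem mu_seg_eq_le (n v : ℕ) : mu {X | seg X n = v} ≤ 2⁻¹ ^ n := by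
  by_cases hv : v < 2 ^ n
  · exact (mu_seg_eq hv).le
  · have : {X | seg X n = v} = ∅ := by
      ext X
      simp only [Set.mem_ofPred_eq, Set.mem_empty_iff_false, iff_false]
      rintro rfl
      exact hv (seg_lt _ _)
    simp [this]

/-- The minimal strings enumerated by a monotone representation: in `(l, s, n, v)`, the number `v`
codes a string of length `l` in the `n`-th class and `s` codes the oracle up to `l`. -/
def New (R : ℕ × ℕ × ℕ × ℕ → Prop) (p : ℕ × ℕ × ℕ × ℕ) : Prop :=
  p.2.2.2 < 2 ^ p.1 ∧ R p ∧
    (p.1 = 0 ∨ ¬ R (p.1 - 1, p.2.1 % 2 ^ (p.1 - 1), p.2.2.1, p.2.2.2 % 2 ^ (p.1 - 1)))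

theorem primrecPred_new {R : ℕ × ℕ × ℕ × ℕ → Prop} (hR : PrimrecPred R) :
    PrimrecPred (New R) := by
  unfold New
  fun_prop

variable {a : ℕ → Bool} {U : ℕ → Set (ℕ → Bool)} {R : ℕ × ℕ × ℕ × ℕ → Prop}

theorem new_seg_iff (n l : ℕ) (X : ℕ → Bool) : New R (l, seg a l, n, seg X l) ↔
    R (l, seg a l, n, seg X l) ∧ (l = 0 ∨ ¬ R (l - 1, seg a (l - 1), n, seg X (l - 1))) := by
  simp [New, seg_lt, seg_mod _ (Nat.sub_le l 1)]

theorem Rep.mem_iff_new (h : Rep a U R) (n : ℕ) (X : ℕ → Bool) :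
    X ∈ U n ↔ ∃ l, New R (l, seg a l, n, seg X l) := by
  classical
  simp only [h.2, new_seg_iff]
  constructor
  · intro hs
    refine ⟨Nat.find hs, Nat.find_spec hs, ?_⟩
    rcases Nat.eq_zero_or_pos (Nat.find hs) with h0 | h0
    · exact .inl h0
    · exact .inr (Nat.find_min hs (by omega))
  · exact fun ⟨l, hl, _⟩ => ⟨l, hl⟩

theorem MonoRep.new_unique (h : MonoRep a R) {n l m : ℕ} {X : ℕ → Bool}
    (hl : New R (l, seg a l, n, seg X l)) (hm : New R (m, seg a m, n, seg X m)) : l = m := by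
  wlog hlm : l < m generalizing l m
  · by_contra hne
    exact hne (this hm hl (by omega)).symm
  rw [new_seg_iff] at hl hm
  rcases hm.2 with h0 | h0
  · omega
  · exact absurd (h n X l (m - 1) (by omega) hl.1) h0

theorem tsum_new_le (h : Rep a U R) (hm : MonoRep a R) (n : ℕ) :
    ∑' p : {p : ℕ × ℕ | New R (p.1, seg a p.1, n, p.2)}, (2⁻¹ : ℝ≥0∞) ^ (p : ℕ × ℕ).1 ≤
      mu (U n) := by
  calc _ = ∑' p : {p : ℕ × ℕ | New R (p.1, seg a p.1, n, p.2)},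
        mu {X | seg X (p : ℕ × ℕ).1 = (p : ℕ × ℕ).2} :=
        tsum_congr fun p => (mu_seg_eq p.2.1).symm
    _ = mu (⋃ p : {p : ℕ × ℕ | New R (p.1, seg a p.1, n, p.2)},
        {X | seg X (p : ℕ × ℕ).1 = (p : ℕ × ℕ).2}) := by
        refine (measure_iUnion ?_ fun p : {p : ℕ × ℕ | New R (p.1, seg a p.1, n, p.2)} =>
          measurableSet_seg (p : ℕ × ℕ).1 fun v => v = (p : ℕ × ℕ).2).symm
        rintro ⟨⟨l, v⟩, hp⟩ ⟨⟨m, w⟩, hq⟩ hpq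
        refine Set.disjoint_left.2 fun X hX hX' => hpq ?_
        simp only [Set.mem_ofPred_eq] at hX hX' hp hq
        subst hX hX'
        obtain rfl := hm.new_unique hp hq
        rfl
    _ ≤ mu (U n) := by
        refine measure_mono (Set.iUnion_subset fun p X hX => ?_)
        refine (h.mem_iff_new n X).2 ⟨(p : ℕ × ℕ).1, ?_⟩
        have := p.2
        simp only [Set.mem_ofPred_eq] at hX this
        rwa [hX]

theorem inv_two_pow_le_mu_of_new (h : Rep a U R) (hm : MonoRep a R) {n l v : ℕ}
    (hl : New R (l, seg a l, n, v)) : (2⁻¹ : ℝ≥0∞) ^ l ≤ mu (U n) :=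
  (ENNReal.le_tsum (f := fun p : {p : ℕ × ℕ | New R (p.1, seg a p.1, n, p.2)} =>
    (2⁻¹ : ℝ≥0∞) ^ (p : ℕ × ℕ).1) ⟨(l, v), hl⟩).trans (tsum_new_le h hm n)

end New

section UniversalTest

/-- An effectively open class of measure at most one half whose complement consists of
Martin-Löf random sequences. -/
def univClass : Set (ℕ → Bool) :=
  {X | ∃ x ∈ univSet, x.unpair.1.unpair.1 = x.unpair.2 + 1 ∧
    seg X x.unpair.1.unpair.1 = x.unpair.1.unpair.2}

theorem exists_rep_univClass : ∃ R, Rep (bit ∅) (fun _ => univClass) R ∧ MonoRep (bit ∅) R := by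
  obtain ⟨R, hR, hS, hmono⟩ := ce_univSet.exists_mono
  refine Rep.exists_mono (R := fun p => ∃ x < p.1, R (p.1, x) ∧
    x.unpair.1.unpair.1 = x.unpair.2 + 1 ∧
    p.2.2.2 % 2 ^ x.unpair.1.unpair.1 = x.unpair.1.unpair.2) ⟨?_, fun n X => ?_⟩
  · exact PrimrecPred.exists_lt' (by fun_prop) (by fun_prop)
  have hle : ∀ x : ℕ, x.unpair.1.unpair.1 ≤ x := fun x =>
    (Nat.unpair_left_le _).trans (Nat.unpair_left_le _)
  constructor
  · rintro ⟨x, hx, h1, h2⟩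
    obtain ⟨s, hs⟩ := (hS x).1 hx
    refine ⟨s + x + 1, x, by simp only; omega, hmono x s _ (by simp only; omega) hs, h1, ?_⟩
    simp only
    rw [seg_mod _ (by have := hle x; omega), h2]
  · rintro ⟨s, x, hx, h0, h1, h2⟩
    refine ⟨x, (hS x).2 ⟨s, h0⟩, h1, ?_⟩
    simp only at hx h2
    rwa [seg_mod _ (by have := hle x; omega)] at h2

theorem mu_univClass_le : mu univClass ≤ 2⁻¹ := by
  calc mu univClass ≤ mu (⋃ x : univSet, {X | (x : ℕ).unpair.1.unpair.1 = (x : ℕ).unpair.2 + 1 ∧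
        seg X (x : ℕ).unpair.1.unpair.1 = (x : ℕ).unpair.1.unpair.2}) := by
        refine measure_mono ?_
        rintro X ⟨x, hx, h⟩
        exact Set.mem_iUnion.2 ⟨⟨x, hx⟩, h⟩
    _ ≤ ∑' x : univSet, 2⁻¹ * 2⁻¹ ^ (x : ℕ).unpair.2 := by
        refine (measure_iUnion_le _).trans (ENNReal.tsum_le_tsum fun x => ?_)
        by_cases h : (x : ℕ).unpair.1.unpair.1 = (x : ℕ).unpair.2 + 1
        · refine (measure_mono fun X hX => hX.2).trans ((mu_seg_eq_le _ _).trans ?_)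
          rw [h, pow_succ, mul_comm]
        · simp [h]
    _ = 2⁻¹ * wt univSet := by rw [ENNReal.tsum_mul_left, wt]
    _ ≤ 2⁻¹ * 1 := by gcongr; exact wt_univSet_le
    _ = 2⁻¹ := mul_one _

theorem two_pow_mul_inv_two_pow {m n : ℕ} (h : n ≤ m) :
    (2 : ℝ≥0∞) ^ n * 2⁻¹ ^ m = 2⁻¹ ^ (m - n) := by
  obtain ⟨d, rfl⟩ := Nat.exists_eq_add_of_le h
  rw [pow_add, ← mul_assoc, ← mul_pow, ENNReal.mul_inv_cancel (by simp) (by simp), one_pow,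
    one_mul, Nat.add_sub_cancel_left]

theorem inv_two_pow_le_iff {m n : ℕ} : (2⁻¹ : ℝ≥0∞) ^ m ≤ 2⁻¹ ^ n ↔ n ≤ m := by
  rw [← ENNReal.inv_pow, ← ENNReal.inv_pow, ENNReal.inv_le_inv]
  exact_mod_cast Nat.pow_le_pow_iff_right (a := 2) (by norm_num)

theorem tsum_inv_two_pow : ∑' n : ℕ, (2⁻¹ : ℝ≥0∞) ^ n = 2 := by
  rw [ENNReal.tsum_geometric, ENNReal.one_sub_inv_two, inv_inv]

theorem mlRandom_of_notMem_univClass {X : ℕ → Bool} (hX : X ∉ univClass) : MLRandom ∅ X := by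
  rintro U ⟨W, hW, hUW, hU, hmu⟩ hXU
  obtain ⟨R₀, hR₀⟩ := hW.exists_rep
  obtain ⟨R, hR, hmono⟩ := hR₀.exists_mono
  obtain rfl : U = fun n => Cyl (W n) := funext hUW
  set S : Set ℕ := {x | x.unpair.2 ≤ x.unpair.1.unpair.1 ∧ New R (x.unpair.1.unpair.1, 0,
    2 * (x.unpair.1.unpair.1 - x.unpair.2), x.unpair.1.unpair.2)} with hS
  have hce : Ce S := by
    refine ⟨fun p => p.2 ∈ S, ?_, by simp⟩
    have := primrecPred_new hR.1
    simp only [hS, Set.mem_ofPred_eq]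
    fun_prop
  have hwt : wt S ≤ 2 := by
    calc wt S ≤ ∑' q : (Σ n : ℕ, {p : ℕ × ℕ | New R (p.1, seg (bit ∅) p.1, 2 * n, p.2)}),
          2 ^ q.1 * 2⁻¹ ^ (q.2 : ℕ × ℕ).1 := by
          refine wt_le_of_exists (fun q => (q.1, (q.2 : ℕ × ℕ)))
            (fun x => (x.unpair.1.unpair.1 - x.unpair.2,
              (x.unpair.1.unpair.1, x.unpair.1.unpair.2))) ?_ ?_
          · rintro x ⟨hx, -⟩ y ⟨hy, -⟩ hxy
            simp only [Prod.mk.injEq] at hxy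
            rw [← Nat.pair_unpair x, ← Nat.pair_unpair y]
            congr 1
            · rw [← Nat.pair_unpair x.unpair.1, hxy.2.1, hxy.2.2, Nat.pair_unpair]
            · omega
          · rintro x ⟨hx, h⟩
            refine ⟨⟨x.unpair.1.unpair.1 - x.unpair.2, (x.unpair.1.unpair.1,
              x.unpair.1.unpair.2), by simpa [seg_bit_empty] using h⟩, rfl, ?_⟩
            simp only
            rw [two_pow_mul_inv_two_pow (Nat.sub_le _ _), Nat.sub_sub_self hx]
      _ = ∑' n : ℕ, 2 ^ n * ∑' p : {p : ℕ × ℕ | New R (p.1, seg (bit ∅) p.1, 2 * n, p.2)},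
          2⁻¹ ^ (p : ℕ × ℕ).1 := by
          rw [ENNReal.tsum_sigma']
          simp only [ENNReal.tsum_mul_left]
      _ ≤ ∑' n : ℕ, 2 ^ n * 2⁻¹ ^ (2 * n) := by
          gcongr with n
          exact (tsum_new_le hR hmono _).trans (hmu _)
      _ = 2 := by
          refine Eq.trans (tsum_congr fun n => ?_) tsum_inv_two_pow
          rw [two_pow_mul_inv_two_pow (by omega), two_mul, Nat.add_sub_cancel]
  obtain ⟨c, hc⟩ := hce.exists_mem_univSet (hwt.trans_lt (by simp)).ne
  obtain ⟨l, hl⟩ := (hR.mem_iff_new (2 * (c + 1)) X).1 (Set.mem_iInter.1 hXU _)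
  have hle : 2 * (c + 1) ≤ l :=
    inv_two_pow_le_iff.1 ((inv_two_pow_le_mu_of_new hR hmono hl).trans (hmu _))
  have hmem : Nat.pair (Nat.pair l (seg X l)) (l - (c + 1)) ∈ S := by
    rw [seg_bit_empty] at hl
    simp only [hS, Set.mem_ofPred_eq, Nat.unpair_pair]
    refine ⟨Nat.sub_le _ _, ?_⟩
    rwa [Nat.sub_sub_self (by omega)]
  refine hX ⟨_, hc _ _ hmem, ?_, ?_⟩ <;> simp only [Nat.unpair_pair]
  omega

end UniversalTest

section Category

/-- A set of sequences is open in the product topology. -/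
def SegOpen (U : Set (ℕ → Bool)) : Prop :=
  ∀ X ∈ U, ∃ m, ∀ Y, seg Y m = seg X m → Y ∈ U

theorem seg_eq_of_le {X Y : ℕ → Bool} {m n : ℕ} (h : m ≤ n) (hXY : seg X n = seg Y n) :
    seg X m = seg Y m := by
  rw [← seg_mod X h, ← seg_mod Y h, hXY]

theorem Rep.segOpen {a : ℕ → Bool} {U : ℕ → Set (ℕ → Bool)} {R : ℕ × ℕ × ℕ × ℕ → Prop}
    (h : Rep a U R) (n : ℕ) : SegOpen (U n) := by
  intro X hX
  obtain ⟨s, hs⟩ := (h.2 n X).1 hX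
  exact ⟨s, fun Y hY => (h.2 n Y).2 ⟨s, by rwa [hY]⟩⟩

theorem exists_extension {Q U : Set (ℕ → Bool)} (hU : SegOpen U) {X : ℕ → Bool} {p : ℕ}
    (h : mu (({Y | seg Y p = seg X p} ∩ U) \ Q) ≠ 0) :
    ∃ X' p', p < p' ∧ seg X' p = seg X p ∧ {Y | seg Y p' = seg X' p'} ⊆ U ∧
      mu ({Y | seg Y p' = seg X' p'} \ Q) ≠ 0 := by
  by_contra! hc
  refine h (measure_mono_null (t := ⋃ q : ℕ × ℕ, ⋃ _ : p < q.1 ∧ q.2 % 2 ^ p = seg X p ∧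
    {Y | seg Y q.1 = q.2} ⊆ U, {Y | seg Y q.1 = q.2} \ Q) ?_ ?_)
  · rintro Y ⟨⟨hY, hYU⟩, hYQ⟩
    obtain ⟨m, hm⟩ := hU Y hYU
    simp only [Set.mem_iUnion]
    refine ⟨(m + p + 1, seg Y (m + p + 1)), ⟨by simp only; omega, ?_, ?_⟩, rfl, hYQ⟩
    · simp only
      rw [seg_mod _ (by omega)]
      exact hY
    · intro Z hZ
      exact hm Z (seg_eq_of_le (by omega) hZ)
  · refine measure_iUnion_null fun q => measure_iUnion_null fun hq => ?_
    obtain ⟨hq1, hq2, hq3⟩ := hq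
    by_contra hne
    obtain ⟨X', hX', -⟩ := nonempty_of_measure_ne_zero hne
    simp only [Set.mem_ofPred_eq] at hX'
    rw [← hX'] at hq2 hq3 hne
    exact hne (hc X' q.1 hq1 (by rw [← hq2, seg_mod _ hq1.le]) hq3)

theorem exists_cylinder_null {Q : Set (ℕ → Bool)} {U : ℕ → Set (ℕ → Bool)} (hQ : SegOpen Q)
    (hU : ∀ n, SegOpen (U n)) (hmu : mu Qᶜ ≠ 0) (hne : ∀ Y ∉ Q, Y ∉ ⋂ n, U n) :
    ∃ p w n, mu ({Y | seg Y p = w} \ Q) ≠ 0 ∧ mu (({Y | seg Y p = w} ∩ U n) \ Q) = 0 := by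
  by_contra! hc
  have step : ∀ (n : ℕ) (q : {q : (ℕ → Bool) × ℕ // mu ({Y | seg Y q.2 = seg q.1 q.2} \ Q) ≠ 0}),
      ∃ q' : {q : (ℕ → Bool) × ℕ // mu ({Y | seg Y q.2 = seg q.1 q.2} \ Q) ≠ 0},
      q.1.2 < q'.1.2 ∧ seg q'.1.1 q.1.2 = seg q.1.1 q.1.2 ∧
      {Y | seg Y q'.1.2 = seg q'.1.1 q'.1.2} ⊆ U n := by
    rintro n ⟨⟨X, p⟩, hq⟩
    obtain ⟨X', p', h1, h2, h3, h4⟩ := exists_extension (hU n) (hc p (seg X p) n hq)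
    exact ⟨⟨(X', p'), h4⟩, h1, h2, h3⟩
  choose f hf1 hf2 hf3 using step
  let g : ℕ → {q : (ℕ → Bool) × ℕ // mu ({Y | seg Y q.2 = seg q.1 q.2} \ Q) ≠ 0} :=
    fun k => Nat.rec ⟨(fun _ => false, 0), by simpa [seg, ← Set.compl_eq_univ_sdiff] using hmu⟩
      (fun n q => f n q) k
  have hg : ∀ k, g (k + 1) = f k (g k) := fun k => rfl
  have hle : ∀ k, k ≤ (g k).1.2 := by
    intro k
    induction k with
    | zero => omega
    | succ k ih =>
      rw [hg]
      have := hf1 k (g k)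
      omega
  have hmono : Monotone fun k => (g k).1.2 :=
    monotone_nat_of_le_succ fun k => by rw [hg]; exact (hf1 k (g k)).le
  have hseg : ∀ k j, k ≤ j → seg (g j).1.1 (g k).1.2 = seg (g k).1.1 (g k).1.2 := by
    intro k j hkj
    induction j, hkj using Nat.le_induction with
    | base => rfl
    | succ j hkj ih =>
      rw [← ih, hg]
      exact seg_eq_of_le (hmono hkj) (hf2 j (g j))
  have hY : ∀ k, seg (fun i => (g (i + 1)).1.1 i) (g k).1.2 = seg (g k).1.1 (g k).1.2 := by
    intro k
    refine seg_eq_iff.2 fun i hi => ?_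
    rcases le_total k (i + 1) with h | h
    · exact seg_eq_iff.1 (hseg k (i + 1) h) i hi
    · exact (seg_eq_iff.1 (hseg (i + 1) k h) i (hle (i + 1))).symm
  refine hne (fun i => (g (i + 1)).1.1 i) (fun hYQ => ?_) (Set.mem_iInter.2 fun n => ?_)
  · obtain ⟨m, hm⟩ := hQ _ hYQ
    refine (g m).2 ?_
    have : {Y | seg Y (g m).1.2 = seg (g m).1.1 (g m).1.2} \ Q = ∅ := by
      rw [Set.sdiff_eq_empty]
      intro Z hZ
      exact hm Z (seg_eq_of_le (hle m) (Eq.trans hZ (hY m).symm))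
    rw [this, measure_empty]
  · exact hf3 n (g n) (hY (n + 1))

end Category

section Transfer

/-- Sets effectively enumerable relative to `a`. -/
def CeRel (a : ℕ → Bool) (S : Set ℕ) : Prop :=
  ∃ R : ℕ × ℕ × ℕ → Prop, PrimrecPred R ∧ ∀ x, x ∈ S ↔ ∃ s, R (s, seg a s, x)

theorem CeRel.exists_mono {a : ℕ → Bool} {S : Set ℕ} (h : CeRel a S) :
    ∃ R : ℕ × ℕ × ℕ → Prop, PrimrecPred R ∧ (∀ x, x ∈ S ↔ ∃ s, R (s, seg a s, x)) ∧
      ∀ x s t, s ≤ t → R (s, seg a s, x) → R (t, seg a t, x) := by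
  obtain ⟨R, hR, hS⟩ := h
  have key : ∀ s x, (∃ t < s + 1, R (t, seg a s % 2 ^ t, x)) ↔ ∃ t ≤ s, R (t, seg a t, x) := by
    intro s x
    simp only [Nat.lt_succ_iff]
    exact exists_congr fun t => and_congr_right fun h => by rw [seg_mod _ h]
  refine ⟨fun p => ∃ t < p.1 + 1, R (t, p.2.1 % 2 ^ t, p.2.2), ?_, ?_, ?_⟩
  · exact PrimrecPred.exists_lt' (by fun_prop) (by fun_prop)
  · intro x
    simp only [key, hS]
    exact ⟨fun ⟨s, h⟩ => ⟨s, s, le_rfl, h⟩, fun ⟨_, t, _, h⟩ => ⟨t, h⟩⟩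
  · intro x s t hst
    simp only [key]
    exact fun ⟨k, hk, h⟩ => ⟨k, hk.trans hst, h⟩

/-- The first `k + n` positions in the column of a pair `x` with second component `k`. -/
def block (n x : ℕ) : Finset ℕ := (Finset.range (x.unpair.2 + n)).image (Nat.pair x)

theorem card_block (n x : ℕ) : (block n x).card = x.unpair.2 + n := by
  rw [block, Finset.card_image_of_injective, Finset.card_range]
  intro i j h
  simpa using h

theorem disjoint_block (n : ℕ) {x y : ℕ} (h : x ≠ y) : Disjoint (block n x) (block n y) := by
  rw [Finset.disjoint_left]
  intro m hx hy
  simp only [block, Finset.mem_image] at hx hy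
  obtain ⟨i, -, rfl⟩ := hx
  obtain ⟨j, -, hj⟩ := hy
  exact h (Nat.pair_eq_pair.1 hj).1.symm

theorem mem_vanish_block {n x : ℕ} {X : ℕ → Bool} :
    X ∈ vanish (block n x) ↔ ∀ j < x.unpair.2 + n, X (Nat.pair x j) = false := by
  simp [vanish, block]

theorem mu_vanish' (B : Finset ℕ) : mu (vanish B) = 2⁻¹ ^ B.card := by
  rw [← ofReal_measureReal, mu_vanish, ENNReal.ofReal_pow (by norm_num),
    ENNReal.ofReal_inv_of_pos (by norm_num)]
  simp

theorem mlTest_vanish {A I : Set ℕ} (hI : CeRel (bit A) I) (hwt : wt I ≤ 1) :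
    MLTest A fun n => {X | ∃ x ∈ I, X ∈ vanish (block n x)} := by
  obtain ⟨R, hR, hIR, hmono⟩ := hI.exists_mono
  have hrep : Rep (bit A) (fun n => {X | ∃ x ∈ I, X ∈ vanish (block n x)}) fun p =>
      ∃ x < p.1, R (p.1, p.2.1, x) ∧ ∀ j < x.unpair.2 + p.2.2.1,
        Nat.pair x j < p.1 ∧ p.2.2.2.testBit (Nat.pair x j) = false := by
    constructor
    · refine PrimrecPred.exists_lt' ?_ (by fun_prop)
      refine PrimrecPred.and (by fun_prop) ?_
      exact PrimrecPred.forall_lt' (by fun_prop) (by fun_prop)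
    intro n X
    constructor
    · rintro ⟨x, hx, hX⟩
      rw [mem_vanish_block] at hX
      obtain ⟨s, hs⟩ := (hIR x).1 hx
      refine ⟨s + x + Nat.pair x (x.unpair.2 + n) + 1, x, by simp only; omega,
        hmono x s _ (by omega) hs, fun j hj => ?_⟩
      replace hj : j < x.unpair.2 + n := hj
      have h1 := Nat.pair_lt_pair_right x hj
      have h2 : Nat.pair x j < s + x + Nat.pair x (x.unpair.2 + n) + 1 := by omega
      exact ⟨h2, by rw [testBit_seg _ h2]; exact hX j hj⟩
    · rintro ⟨s, x, -, hs, h⟩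
      refine ⟨x, (hIR x).2 ⟨s, hs⟩, mem_vanish_block.2 fun j hj => ?_⟩
      have := h j hj
      rw [testBit_seg _ this.1] at this
      exact this.2
  obtain ⟨W, hW, hUW⟩ := hrep.exists_ceSeqIn
  refine ⟨W, hW, hUW, fun n => ?_, fun n => ?_⟩
  · rintro X ⟨x, hx, hX⟩
    rw [mem_vanish_block] at hX
    exact ⟨x, hx, mem_vanish_block.2 fun j hj => hX j (by omega)⟩
  · calc mu {X | ∃ x ∈ I, X ∈ vanish (block n x)}
        ≤ mu (⋃ x : I, vanish (block n x)) := by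
          refine measure_mono ?_
          rintro X ⟨x, hx, hX⟩
          exact Set.mem_iUnion.2 ⟨⟨x, hx⟩, hX⟩
      _ ≤ ∑' x : I, 2⁻¹ ^ n * 2⁻¹ ^ (x : ℕ).unpair.2 := by
          refine (measure_iUnion_le _).trans (ENNReal.tsum_le_tsum fun x => ?_)
          rw [mu_vanish', card_block, pow_add, mul_comm]
      _ = 2⁻¹ ^ n * wt I := by rw [ENNReal.tsum_mul_left, wt]
      _ ≤ 2⁻¹ ^ n * 1 := by gcongr
      _ = 2⁻¹ ^ n := mul_one _

open Classical in
/-- The number of strings of length `n` whose code has the property `P`. -/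
noncomputable def segCount (n : ℕ) (P : ℕ → Prop) : ℕ := ((Finset.range (2 ^ n)).filter P).card

theorem primrec_segCount {α : Type*} [Primcodable α] {f : α → ℕ} {R : α → ℕ → Prop}
    (hf : Primrec f) (hR : PrimrecPred fun p : α × ℕ => R p.1 p.2) :
    Primrec fun a => segCount (f a) (R a) :=
  Primrec.card_filter_range hR (by fun_prop)

theorem mu_real_eq_segCount (n : ℕ) (P : ℕ → Prop) :
    mu.real {X | P (seg X n)} = segCount n P / 2 ^ n :=
  mu_real_seg_mem n P

theorem sum_inv_two_pow_eq_ofReal (F : Finset ℕ) :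
    ∑ x ∈ F, (2⁻¹ : ℝ≥0∞) ^ x.unpair.2 = ENNReal.ofReal (∑ x ∈ F, (2⁻¹ : ℝ) ^ x.unpair.2) := by
  rw [ENNReal.ofReal_sum_of_nonneg fun x _ => by positivity]
  refine Finset.sum_congr rfl fun x _ => ?_
  rw [ENNReal.ofReal_pow (by norm_num), ENNReal.ofReal_inv_of_pos (by norm_num)]
  simp

theorem sum_inv_two_pow_le_two (F : Finset ℕ) : ∑ x ∈ F, (2⁻¹ : ℝ) ^ x ≤ 2 := by
  have h : Summable fun x : ℕ => (2⁻¹ : ℝ) ^ x :=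
    summable_geometric_of_lt_one (by norm_num) (by norm_num)
  refine (h.sum_le_tsum F fun x _ => by positivity).trans ?_
  rw [tsum_geometric_of_lt_one (by norm_num) (by norm_num)]
  norm_num

/-- If the classes `vanish (block n x)`, `x ∈ J`, nearly miss a set of positive measure then `J` has
finite weight. -/
theorem wt_ne_top_of_small_inter {D : Set (ℕ → Bool)} (hD : mu D ≠ 0)
    {n d : ℕ} (hd : 4 * (2⁻¹ : ℝ) ^ d ≤ mu.real D) {J : Set ℕ}
    (hJ : ∀ x ∈ J, mu.real (D ∩ vanish (block n x)) ≤ 2⁻¹ ^ (x + d)) : wt J ≠ ∞ := by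
  have hδ : 0 < mu.real D := by
    rw [measureReal_def]
    exact ENNReal.toReal_pos hD (measure_ne_top _ _)
  suffices h : wt J ≤ ENNReal.ofReal (2 ^ n * (-Real.log (mu.real D / 2))) from
    (h.trans_lt ENNReal.ofReal_lt_top).ne
  refine wt_le_of_forall_finset fun F hF => ?_
  rw [sum_inv_two_pow_eq_ofReal]
  refine ENNReal.ofReal_le_ofReal ?_
  have h1 : mu.real D ≤ ∏ x ∈ F, (1 - (2⁻¹ : ℝ) ^ (x.unpair.2 + n)) +
      ∑ x ∈ F, 2⁻¹ ^ (x + d) := by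
    have hsub : D ⊆ (⋂ x ∈ F, (vanish (block n x))ᶜ) ∪ ⋃ x ∈ F, (D ∩ vanish (block n x)) := by
      intro X hX
      by_cases h : X ∈ ⋂ x ∈ F, (vanish (block n x))ᶜ
      · exact .inl h
      · right
        simp only [Set.mem_iInter, Set.mem_compl_iff, not_forall, not_not] at h
        obtain ⟨x, hx, hX'⟩ := h
        exact Set.mem_biUnion hx ⟨hX, hX'⟩
    refine (measureReal_mono hsub).trans ((measureReal_union_le _ _).trans (add_le_add ?_ ?_))
    · have := mu_iInter_compl_vanish F (block n) (fun x y => disjoint_block n) ∅ (by simp)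
      have hv : vanish ∅ = Set.univ := by simp [vanish]
      rw [hv, Set.inter_univ] at this
      rw [this]
      simp [card_block]
    · exact (measureReal_biUnion_finset_le _ _).trans
        (Finset.sum_le_sum fun x hx => hJ x (hF hx))
  have h2 : ∑ x ∈ F, (2⁻¹ : ℝ) ^ (x + d) ≤ mu.real D / 2 := by
    calc _ = 2⁻¹ ^ d * ∑ x ∈ F, (2⁻¹ : ℝ) ^ x := by
          rw [Finset.mul_sum]
          exact Finset.sum_congr rfl fun x _ => by rw [pow_add, mul_comm]
      _ ≤ 2⁻¹ ^ d * 2 := by gcongr; exact sum_inv_two_pow_le_two F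
      _ ≤ _ := by linarith
  have h3 : ∏ x ∈ F, (1 - (2⁻¹ : ℝ) ^ (x.unpair.2 + n)) ≤
      Real.exp (-∑ x ∈ F, (2⁻¹ : ℝ) ^ (x.unpair.2 + n)) := by
    rw [← Finset.sum_neg_distrib, Real.exp_sum]
    refine Finset.prod_le_prod (fun x _ => ?_) fun x _ => ?_
    · rw [sub_nonneg]
      exact pow_le_one₀ (by norm_num) (by norm_num)
    · have := Real.add_one_le_exp (-(2⁻¹ : ℝ) ^ (x.unpair.2 + n))
      linarith
  have h4 : Real.log (mu.real D / 2) ≤ -∑ x ∈ F, (2⁻¹ : ℝ) ^ (x.unpair.2 + n) := by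
    rw [Real.log_le_iff_le_exp (by positivity)]
    linarith
  have h5 : ∑ x ∈ F, (2⁻¹ : ℝ) ^ (x.unpair.2 + n) =
      2⁻¹ ^ n * ∑ x ∈ F, (2⁻¹ : ℝ) ^ x.unpair.2 := by
    rw [Finset.mul_sum]
    exact Finset.sum_congr rfl fun x _ => by rw [pow_add, mul_comm]
  have h6 : (2 : ℝ) ^ n * 2⁻¹ ^ n = 1 := by rw [← mul_pow]; norm_num
  calc ∑ x ∈ F, (2⁻¹ : ℝ) ^ x.unpair.2
      = 2 ^ n * (2⁻¹ ^ n * ∑ x ∈ F, (2⁻¹ : ℝ) ^ x.unpair.2) := by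
        rw [← mul_assoc, h6, one_mul]
    _ ≤ _ := by
        rw [← h5]
        gcongr
        linarith

/-- Every set of finite weight enumerable in a set that is low for randomness is covered by an
effectively enumerable set of finite weight. -/
theorem exists_ce_superset {A : Set ℕ} (h : ∀ X, MLRandom ∅ X → MLRandom A X) {I : Set ℕ}
    (hI : CeRel (bit A) I) (hwt : wt I ≤ 1) : ∃ J, Ce J ∧ I ⊆ J ∧ wt J ≠ ∞ := by
  have htest := mlTest_vanish hI hwt
  obtain ⟨RQ, hQ, hQmono⟩ := exists_rep_univClass
  have hUopen : ∀ n, SegOpen {X | ∃ x ∈ I, X ∈ vanish (block n x)} := by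
    obtain ⟨W, hW, hUW, -⟩ := htest
    obtain ⟨R, hR⟩ := hW.exists_rep
    intro n
    have := hR.segOpen n
    rwa [← hUW n] at this
  have hQc : mu univClassᶜ ≠ 0 := by
    rw [prob_compl_eq_one_sub (measurableSet_of_rep hQ 0)]
    refine (tsub_pos_of_lt (mu_univClass_le.trans_lt ?_)).ne'
    exact ENNReal.one_half_lt_one
  obtain ⟨p, w, n, hpos, hnull⟩ := exists_cylinder_null (hQ.segOpen 0) hUopen hQc
    (fun Y hY => h Y (mlRandom_of_notMem_univClass hY) _ htest)
  set D : Set (ℕ → Bool) := {Y | seg Y p = w} \ univClass with hD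
  obtain ⟨d, hd⟩ : ∃ d, 4 * (2⁻¹ : ℝ) ^ d ≤ mu.real D := by
    have hδ : 0 < mu.real D := by
      rw [measureReal_def]
      exact ENNReal.toReal_pos hpos (measure_ne_top _ _)
    obtain ⟨d, hd⟩ := exists_pow_lt_of_lt_one (show 0 < mu.real D / 4 by positivity)
      (show (2⁻¹ : ℝ) < 1 by norm_num)
    exact ⟨d, by linarith⟩
  let P : ℕ → ℕ → ℕ → Prop := fun x t v => v % 2 ^ p = w ∧
    (∀ j < x.unpair.2 + n, v.testBit (Nat.pair x j) = false) ∧ ¬ RQ (t, 0, 0, v)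
  let C : ℕ × ℕ → Prop := fun q => p ≤ q.1 ∧ Nat.pair q.2 (q.2.unpair.2 + n) ≤ q.1 ∧
    segCount q.1 (P q.2 q.1) * 2 ^ (q.2 + d) ≤ 2 ^ q.1
  have hC : PrimrecPred C := by
    have h1 : PrimrecPred fun q : (ℕ × ℕ) × ℕ => P q.1.2 q.1.1 q.2 := by
      refine PrimrecPred.and (by fun_prop) (PrimrecPred.and ?_ ?_)
      · exact PrimrecPred.forall_lt' (by fun_prop) (by fun_prop)
      · have := hQ.1
        fun_prop
    have h2 := primrec_segCount (R := fun q : ℕ × ℕ => P q.2 q.1)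
      (f := fun q => q.1) (by fun_prop) h1
    exact PrimrecPred.and (by fun_prop) (PrimrecPred.and (by fun_prop)
      (Primrec.nat_le.comp (Primrec.nat_mul.comp h2 (by fun_prop)) (by fun_prop)))
  let G : ℕ → ℕ → Set (ℕ → Bool) := fun x t =>
    (({Y | seg Y p = w} ∩ vanish (block n x)) \ {X | RQ (t, 0, 0, seg X t)})
  have hCG : ∀ x t, p ≤ t → Nat.pair x (x.unpair.2 + n) ≤ t →
      (C (t, x) ↔ mu.real (G x t) ≤ 2⁻¹ ^ (x + d)) := by
    intro x t hpt hxt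
    have hG : G x t = {X | P x t (seg X t)} := by
      ext X
      simp only [G, P, Set.mem_sdiff, Set.mem_inter_iff, mem_vanish_block, Set.mem_ofPred_eq,
        and_assoc, seg_mod X hpt]
      refine and_congr_right fun _ => and_congr_left fun _ => forall₂_congr fun j hj => ?_
      rw [testBit_seg _ ((Nat.pair_lt_pair_right x hj).trans_le hxt)]
    rw [hG, mu_real_eq_segCount, inv_pow, div_le_iff₀ (by positivity), ← div_eq_inv_mul,
      le_div_iff₀ (by positivity)]
    simp only [C, hpt, hxt, true_and]
    exact_mod_cast Iff.rfl
  refine ⟨{x | ∃ t, C (t, x)}, ⟨C, hC, fun x => Iff.rfl⟩, fun x hx => ?_, ?_⟩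
  · have hanti : Antitone (G x) := by
      intro s t hst
      refine Set.sdiff_subset_sdiff_right fun X hX => ?_
      have := hQmono 0 X s t hst (by rw [seg_bit_empty]; exact hX)
      rwa [seg_bit_empty] at this
    have hmeas : ∀ t, MeasurableSet (G x t) := fun t =>
      ((measurableSet_seg p (· = w)).inter (measurableSet_vanish _)).diff
        (measurableSet_seg t fun v => RQ (t, 0, 0, v))
    have hlim := tendsto_measure_iInter_atTop (μ := mu) (fun t => (hmeas t).nullMeasurableSet)
      hanti ⟨0, measure_ne_top _ _⟩
    have h0 : mu (⋂ t, G x t) = 0 := by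
      refine measure_mono_null ?_ hnull
      intro X hX
      simp only [Set.mem_iInter] at hX
      refine ⟨⟨(hX 0).1.1, x, hx, (hX 0).1.2⟩, fun hXQ => ?_⟩
      obtain ⟨t, ht⟩ := (hQ.2 0 X).1 hXQ
      rw [seg_bit_empty] at ht
      exact (hX t).2 ht
    rw [h0] at hlim
    have hp : (0 : ℝ≥0∞) < 2⁻¹ ^ (x + d) := ENNReal.pow_pos (ENNReal.inv_pos.2 (by simp)) _
    have hev := hlim.eventually (ge_mem_nhds hp)
    obtain ⟨t, ht, ht1, ht2⟩ := (hev.and ((eventually_ge_atTop p).and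
      (eventually_ge_atTop (Nat.pair x (x.unpair.2 + n))))).exists
    refine ⟨t, (hCG x t ht1 ht2).2 ?_⟩
    have := ENNReal.toReal_mono (by simp) ht
    simpa [measureReal_def] using this
  · refine wt_ne_top_of_small_inter (D := D) hpos (n := n) hd ?_
    rintro x ⟨t, ht⟩
    refine le_trans (measureReal_mono ?_) ((hCG x t ht.1 ht.2.1).1 ht)
    rintro X ⟨⟨hX1, hX2⟩, hX3⟩
    refine ⟨⟨hX1, hX3⟩, fun hX4 => hX2 ((hQ.2 0 X).2 ⟨t, ?_⟩)⟩
    rw [seg_bit_empty]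
    exact hX4

end Transfer

section Limit

theorem mod_two_pow_eq_of_le {v w p q : ℕ} (h : p ≤ q) (hv : v % 2 ^ q = w) :
    v % 2 ^ p = w % 2 ^ p := by
  rw [← hv, Nat.mod_mod_of_dvd _ (pow_dvd_pow 2 h)]

open Classical in
theorem segCount_mono {n : ℕ} {P Q : ℕ → Prop} (h : ∀ v < 2 ^ n, P v → Q v) :
    segCount n P ≤ segCount n Q :=
  Finset.card_le_card (Finset.monotone_filter_right _ fun v hv => h v (Finset.mem_range.1 hv))

open Classical in
theorem of_segCount_le {n : ℕ} {P Q : ℕ → Prop} (h : ∀ v, P v → Q v)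
    (hc : segCount n Q ≤ segCount n P) {v : ℕ} (hv : v < 2 ^ n) (hQ : Q v) : P v := by
  have heq := Finset.eq_of_subset_of_card_le
    (Finset.monotone_filter_right (Finset.range (2 ^ n)) fun v _ => h v) hc
  have hmem := (Finset.ext_iff.1 heq v).2 (Finset.mem_filter.2 ⟨Finset.mem_range.2 hv, hQ⟩)
  exact (Finset.mem_filter.1 hmem).2

/-- A path through a sequence of sets of strings of bounded size is, above some initial segment,
determined by infinitely many of these sets. -/
theorem exists_seg_forall_frequently {α : ℕ → Bool} {T : ℕ → ℕ → Prop} {B : ℕ}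
    (hB : ∀ᶠ l in atTop, segCount l (T l) ≤ B) :
    ∃ p, ∀ q, p ≤ q → ∃ᶠ l in atTop, ∀ v < 2 ^ l, v % 2 ^ p = seg α p → T l v →
      v % 2 ^ q = seg α q := by
  classical
  have hex : ∃ c p, ∀ᶠ l in atTop, segCount l (fun v => v % 2 ^ p = seg α p ∧ T l v) ≤ c := by
    exact ⟨B, 0, hB.mono fun l hl => (segCount_mono fun v _ h => h.2).trans hl⟩
  obtain ⟨p, hp⟩ := Nat.find_spec hex
  refine ⟨p, fun q hpq => ?_⟩
  have hfreq : ∃ᶠ l in atTop, Nat.find hex ≤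
      segCount l (fun v => v % 2 ^ q = seg α q ∧ T l v) := by
    rcases Nat.eq_zero_or_pos (Nat.find hex) with h0 | h0
    · rw [h0]
      exact (Eventually.of_forall fun l => Nat.zero_le _).frequently
    · intro hc
      refine Nat.find_min hex (m := Nat.find hex - 1) (by omega) ⟨q, hc.mono fun l hl => ?_⟩
      simp only [not_le] at hl
      omega
  refine (hfreq.and_eventually hp).mono ?_
  rintro l ⟨h1, h2⟩ v hv hvp hT
  refine (of_segCount_le (P := fun v => v % 2 ^ q = seg α q ∧ T l v) (fun v h => ⟨?_, h.2⟩)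
    (h2.trans h1) hv ⟨hvp, hT⟩).1
  rw [mod_two_pow_eq_of_le hpq h.1, seg_mod _ hpq]

theorem eventually_forall_lt {P : ℕ → ℕ → Prop} (n : ℕ) (h : ∀ i, ∀ᶠ t in atTop, P i t) :
    ∀ᶠ t in atTop, ∀ i < n, P i t :=
  (Set.finite_lt_nat n).eventually_all.2 fun i _ => h i

/-- A path through a limit computable sequence of sets of strings of bounded size is limit
computable. -/
theorem exists_approx_of_bounded {α : ℕ → Bool} {T : ℕ → ℕ → Prop} {B : ℕ}
    (hB : ∀ᶠ l in atTop, segCount l (T l) ≤ B) (hα : ∀ᶠ l in atTop, T l (seg α l))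
    {P : ℕ × ℕ × ℕ → Prop} (hP : PrimrecPred P)
    (hlim : ∀ l v, ∀ᶠ t in atTop, (P (t, l, v) ↔ T l v)) :
    ∃ a : ℕ × ℕ → Prop, PrimrecPred a ∧ ∀ i, ∀ᶠ t in atTop, (a (t, i) ↔ α i = true) := by
  obtain ⟨p, hp⟩ := exists_seg_forall_frequently (α := α) hB
  obtain ⟨l₀, hl₀⟩ := eventually_atTop.1 hα
  let Φ : ℕ → Bool → ℕ → (ℕ → Prop) → Prop := fun i b l Q => i < l ∧ l₀ ≤ l ∧ p ≤ l ∧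
    ∀ v < 2 ^ l, (v % 2 ^ p ≠ seg α p ∨ ¬ Q v) ∨ v.testBit i = b
  let Θ : ℕ → ℕ → Bool → ℕ → Prop := fun t i b l => Φ i b l fun v => P (t, l, v)
  have hΘ : ∀ b, PrimrecPred fun x : (ℕ × ℕ) × ℕ => Θ x.1.1 x.1.2 b x.2 := by
    intro b
    refine PrimrecPred.and (by fun_prop) (PrimrecPred.and (by fun_prop)
      (PrimrecPred.and (by fun_prop) ?_))
    exact PrimrecPred.forall_lt' (by fun_prop) (by fun_prop)
  have hΘlim : ∀ i b l, ∀ᶠ t in atTop, (Θ t i b l ↔ Φ i b l (T l)) := by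
    intro i b l
    filter_upwards [eventually_forall_lt (2 ^ l) (hlim l)] with t ht
    simp only [Θ, Φ]
    refine and_congr_right fun _ => and_congr_right fun _ => and_congr_right fun _ =>
      forall₂_congr fun v hv => ?_
    rw [ht v hv]
  have hsound : ∀ i b l, Φ i b l (T l) → b = α i := by
    rintro i b l ⟨h1, h2, h3, h4⟩
    rcases h4 _ (seg_lt α l) with (h | h) | h
    · exact absurd (seg_mod α h3) h
    · exact absurd (hl₀ l h2) h
    · rw [← h, testBit_seg _ h1]
  have hcomplete : ∀ i, ∃ l, Φ i (α i) l (T l) := by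
    intro i
    obtain ⟨l, h1, h2⟩ := ((hp (max p (i + 1)) (le_max_left _ _)).and_eventually
      (eventually_ge_atTop (i + 1 + l₀ + p))).exists
    refine ⟨l, by omega, by omega, by omega, fun v hv => ?_⟩
    by_cases h3 : v % 2 ^ p = seg α p
    · by_cases h4 : T l v
      · right
        have h5 := h1 v hv h3 h4
        have hi : i < max p (i + 1) := by omega
        have h6 := Nat.testBit_mod_two_pow v (max p (i + 1)) i
        rw [h5, testBit_seg _ hi] at h6
        simpa [hi] using h6.symm
      · exact .inl (.inr h4)
    · exact .inl (.inl h3)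
  refine ⟨fun x => ∃ l < x.1, Θ x.1 x.2 true l ∧ ∀ m < l, ¬ Θ x.1 x.2 false m, ?_, fun i => ?_⟩
  · refine PrimrecPred.exists_lt' (PrimrecPred.and (hΘ true) ?_) (by fun_prop)
    refine PrimrecPred.forall_lt' (R := fun (q : (ℕ × ℕ) × ℕ) m => ¬ Θ q.1.1 q.1.2 false m)
      ?_ (by fun_prop)
    have := hΘ false
    exact PrimrecPred.not (this.comp (f := fun q : ((ℕ × ℕ) × ℕ) × ℕ => (q.1.1, q.2))
      (by fun_prop))
  · obtain ⟨l, hl⟩ := hcomplete i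
    filter_upwards [eventually_gt_atTop l,
      eventually_forall_lt (l + 1) (fun m => hΘlim i true m),
      eventually_forall_lt (l + 1) (fun m => hΘlim i false m)] with t h1 h2 h3
    constructor
    · rintro ⟨m, hm, h4, h5⟩
      by_contra h6
      simp only [Bool.not_eq_true] at h6
      rw [h6] at hl
      rcases Nat.lt_or_ge l m with h7 | h7
      · exact h5 l h7 ((h3 l (by omega)).2 hl)
      · have := hsound i true m ((h2 m (by omega)).1 h4)
        rw [h6] at this
        cases this
    · intro h6
      rw [h6] at hl
      refine ⟨l, h1, (h2 l (by omega)).2 hl, fun m hm h7 => ?_⟩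
      have := hsound i false m ((h3 m (by omega)).1 h7)
      rw [h6] at this
      cases this

theorem Ce.exists_mono_eventually {S : Set ℕ} (h : Ce S) : ∃ R : ℕ × ℕ → Prop, PrimrecPred R ∧
    (∀ x s, R (s, x) → x ∈ S) ∧ ∀ x, ∀ᶠ s in atTop, (R (s, x) ↔ x ∈ S) := by
  obtain ⟨R, hR, hS, hmono⟩ := h.exists_mono
  refine ⟨R, hR, fun x s hx => (hS x).2 ⟨s, hx⟩, fun x => ?_⟩
  by_cases hx : x ∈ S
  · obtain ⟨s, hs⟩ := (hS x).1 hx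
    filter_upwards [eventually_ge_atTop s] with t ht
    simp only [hx, iff_true]
    exact hmono x s t ht hs
  · exact Eventually.of_forall fun s => iff_of_false (fun h => hx ((hS x).2 ⟨s, h⟩)) hx

/-- The pairs `(l, m - d)` such that `J` contains at least `4ᵈ` elements `((l, v), m)`. -/
def heavySet (J : Set ℕ) : Set ℕ :=
  {x | ∃ d, 4 ^ d ≤ segCount x.unpair.1
    fun v => Nat.pair (Nat.pair x.unpair.1 v) (x.unpair.2 + d) ∈ J}

theorem ce_heavySet {J : Set ℕ} (hJ : Ce J) : Ce (heavySet J) := by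
  obtain ⟨R, hR, hsound, hlim⟩ := hJ.exists_mono_eventually
  refine ⟨fun q => ∃ d < q.1, 4 ^ d ≤ segCount q.2.unpair.1
    fun v => R (q.1, Nat.pair (Nat.pair q.2.unpair.1 v) (q.2.unpair.2 + d)), ?_, fun x => ?_⟩
  · refine PrimrecPred.exists_lt' ?_ (by fun_prop)
    refine Primrec.nat_le.comp (by fun_prop) (primrec_segCount (R := fun (q : (ℕ × ℕ) × ℕ) v =>
      R (q.1.1, Nat.pair (Nat.pair q.1.2.unpair.1 v) (q.1.2.unpair.2 + q.2))) ?_ ?_)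
    · fun_prop
    · fun_prop
  · constructor
    · rintro ⟨d, hd⟩
      have h1 := eventually_forall_lt (2 ^ x.unpair.1) fun v =>
        hlim (Nat.pair (Nat.pair x.unpair.1 v) (x.unpair.2 + d))
      obtain ⟨s, h1, h2⟩ := (h1.and (eventually_gt_atTop d)).exists
      refine ⟨s, d, h2, hd.trans (segCount_mono fun v hv => (h1 v hv).2)⟩
    · rintro ⟨s, d, -, hd⟩
      exact ⟨d, hd.trans (segCount_mono fun v _ => hsound _ _)⟩

open Classical in
theorem wt_heavySet_ne_top {J : Set ℕ} (hJ : wt J ≠ ∞) : wt (heavySet J) ≠ ∞ := by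
  have hch : ∀ x : heavySet J, ∃ d, 4 ^ d ≤ segCount (x : ℕ).unpair.1
    fun v => Nat.pair (Nat.pair (x : ℕ).unpair.1 v) ((x : ℕ).unpair.2 + d) ∈ J := fun x => x.2
  choose d hd using hch
  let F : heavySet J → Finset ℕ := fun x => (Finset.range (2 ^ (x : ℕ).unpair.1)).filter fun v =>
    Nat.pair (Nat.pair (x : ℕ).unpair.1 v) ((x : ℕ).unpair.2 + d x) ∈ J
  have h1 : wt (heavySet J) ≤ ∑' y : (Σ x : heavySet J, F x),
      2⁻¹ ^ d y.1 * 2⁻¹ ^ ((y.1 : ℕ).unpair.2 + d y.1) := by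
    rw [ENNReal.tsum_sigma']
    refine ENNReal.tsum_le_tsum fun x => ?_
    simp only
    rw [tsum_fintype, Finset.sum_const, Finset.card_univ, Fintype.card_coe, nsmul_eq_mul]
    have h2 : (4 ^ d x : ℝ≥0∞) ≤ (F x).card := by exact_mod_cast hd x
    refine le_trans (le_of_eq ?_) (mul_le_mul_left h2 _)
    rw [show (4 : ℝ≥0∞) = 2 * 2 by norm_num, pow_add, mul_pow]
    have h3 : (2 : ℝ≥0∞) ^ d x * 2⁻¹ ^ d x = 1 := by
      rw [← mul_pow, ENNReal.mul_inv_cancel (by simp) (by simp), one_pow]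
    calc _ = ((2 : ℝ≥0∞) ^ d x * 2⁻¹ ^ d x) * (2 ^ d x * 2⁻¹ ^ d x) *
          2⁻¹ ^ (x : ℕ).unpair.2 := by rw [h3, one_mul, one_mul]
      _ = _ := by ring
  have h2 : ∑' y : (Σ x : heavySet J, F x), (2⁻¹ : ℝ≥0∞) ^ d y.1 *
      2⁻¹ ^ ((y.1 : ℕ).unpair.2 + d y.1) ≤
      ∑' z : ℕ × J, 2⁻¹ ^ z.1 * 2⁻¹ ^ (z.2 : ℕ).unpair.2 := by
    refine tsum_le_tsum_of_exists (fun z : ℕ × J => (z.1, (z.2 : ℕ)))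
      (q := fun y => (d y.1, Nat.pair (Nat.pair (y.1 : ℕ).unpair.1 y.2)
        ((y.1 : ℕ).unpair.2 + d y.1))) ?_ ?_
    · rintro ⟨x, v⟩ ⟨y, w⟩ h
      simp only [Prod.mk.injEq, Nat.pair_eq_pair] at h
      obtain ⟨h1, ⟨h2, h3⟩, h4⟩ := h
      have hxy : x = y := by
        refine Subtype.ext ?_
        rw [← Nat.pair_unpair (x : ℕ), ← Nat.pair_unpair (y : ℕ), h2,
          show (x : ℕ).unpair.2 = (y : ℕ).unpair.2 by omega]
      subst hxy
      rw [Subtype.ext h3]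
    · rintro ⟨x, v, hv⟩
      exact ⟨(d x, ⟨_, (Finset.mem_filter.1 hv).2⟩), rfl, by simp⟩
  have h3 : ∑' z : ℕ × J, (2⁻¹ : ℝ≥0∞) ^ z.1 * 2⁻¹ ^ (z.2 : ℕ).unpair.2 = 2 * wt J := by
    rw [ENNReal.tsum_prod']
    simp only [ENNReal.tsum_mul_left, ENNReal.tsum_mul_right, tsum_inv_two_pow, wt]
  exact ne_top_of_le_ne_top (ENNReal.mul_ne_top (by simp) hJ) (h1.trans (h2.trans h3.le))

theorem exists_pair_mem_univSet : ∃ c, ∀ l, Nat.pair l (l + c) ∈ univSet := by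
  have h1 : Ce {x | x.unpair.1 = x.unpair.2} :=
    ⟨fun q => q.2.unpair.1 = q.2.unpair.2, by fun_prop, fun x => by simp⟩
  have h2 : wt {x | x.unpair.1 = x.unpair.2} ≤ 2 := by
    rw [← tsum_inv_two_pow]
    refine wt_le_of_exists (fun k => Nat.pair k k) id Function.injective_id.injOn ?_
    intro x hx
    refine ⟨x.unpair.2, ?_, le_rfl⟩
    nth_rw 1 [← hx]
    simp
  obtain ⟨c, hc⟩ := h1.exists_mem_univSet (ne_top_of_le_ne_top (by simp) h2)
  exact ⟨c, fun l => hc l l (by simp)⟩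

/-- The least `k` such that `(l, k)` belongs to the universal set. -/
noncomputable def cost (l : ℕ) : ℕ := sInf {k | Nat.pair l k ∈ univSet}

theorem pair_cost_mem (l : ℕ) : Nat.pair l (cost l) ∈ univSet := by
  obtain ⟨c, hc⟩ := exists_pair_mem_univSet
  exact Nat.sInf_mem (s := {k | Nat.pair l k ∈ univSet}) ⟨_, hc l⟩

theorem cost_le {l k : ℕ} (h : Nat.pair l k ∈ univSet) : cost l ≤ k := Nat.sInf_le h

theorem tendsto_cost : Tendsto cost atTop atTop := by
  refine tendsto_atTop.2 fun d => ?_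
  have h1 : Set.Finite {x : univSet | (2⁻¹ : ℝ≥0∞) ^ d ≤ 2⁻¹ ^ (x : ℕ).unpair.2} :=
    ENNReal.finite_const_le_of_tsum_ne_top (ne_top_of_le_ne_top (by simp) wt_univSet_le)
      (ENNReal.pow_pos (ENNReal.inv_pos.2 (by simp)) _).ne'
  have h2 : Set.Finite {l | cost l ≤ d} := by
    refine (h1.image fun x : univSet => (x : ℕ).unpair.1).subset fun l hl => ?_
    refine ⟨⟨_, pair_cost_mem l⟩, ?_, by simp⟩
    simpa [inv_two_pow_le_iff] using hl
  rw [← Nat.cofinite_eq_atTop]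
  filter_upwards [h2.compl_mem_cofinite] with l hl
  simp only [Set.mem_compl_iff, Set.mem_ofPred_eq] at hl
  omega

theorem exists_segCount_cost_le {J : Set ℕ} (hJ : Ce J) (hwt : wt J ≠ ∞) : ∃ B, ∀ᶠ l in atTop,
    segCount l (fun v => Nat.pair (Nat.pair l v) (cost l) ∈ J) ≤ B := by
  obtain ⟨c, hc⟩ := (ce_heavySet hJ).exists_mem_univSet (wt_heavySet_ne_top hwt)
  refine ⟨4 ^ (c + 1), ?_⟩
  filter_upwards [tendsto_cost.eventually_ge_atTop (c + 1)] with l hl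
  by_contra! h
  have h1 : Nat.pair l (cost l - (c + 1)) ∈ heavySet J := by
    refine ⟨c + 1, ?_⟩
    rw [Nat.unpair_pair, Nat.sub_add_cancel hl]
    exact h.le
  have := cost_le (hc _ _ h1)
  omega

theorem exists_approx_cost : ∃ P : ℕ × ℕ × ℕ → Prop, PrimrecPred P ∧
    (∀ t l k, P (t, l, k) → k < t) ∧
    ∀ l, ∀ᶠ t in atTop, ∀ k, (P (t, l, k) ↔ k = cost l) := by
  obtain ⟨R, hR, hsound, hlim⟩ := ce_univSet.exists_mono_eventually
  refine ⟨fun x => x.2.2 < x.1 ∧ R (x.1, Nat.pair x.2.1 x.2.2) ∧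
    ∀ j < x.2.2, ¬ R (x.1, Nat.pair x.2.1 j), ?_, fun t l k h => h.1, fun l => ?_⟩
  · refine PrimrecPred.and (by fun_prop) (PrimrecPred.and (by fun_prop) ?_)
    exact PrimrecPred.forall_lt' (by fun_prop) (by fun_prop)
  · filter_upwards [eventually_gt_atTop (cost l), hlim (Nat.pair l (cost l))] with t h1 h2 k
    have h3 : ∀ j < cost l, ¬ R (t, Nat.pair l j) := fun j hj h =>
      absurd (cost_le (hsound _ _ h)) (by omega)
    have h4 := h2.2 (pair_cost_mem l)
    constructor
    · rintro ⟨-, h5, h6⟩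
      refine le_antisymm ?_ (cost_le (hsound _ _ h5))
      by_contra! h7
      exact h6 _ h7 h4
    · rintro rfl
      exact ⟨h1, h4, h3⟩

/-- A set that is low for randomness is limit computable. -/
theorem exists_approx {A : Set ℕ} (h : ∀ X, MLRandom ∅ X → MLRandom A X) :
    ∃ a : ℕ × ℕ → Prop, PrimrecPred a ∧ ∀ i, ∀ᶠ t in atTop, (a (t, i) ↔ bit A i = true) := by
  let I : Set ℕ := {x | x.unpair.1.unpair.2 = seg (bit A) x.unpair.1.unpair.1 ∧
    Nat.pair x.unpair.1.unpair.1 x.unpair.2 ∈ univSet}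
  have hI : CeRel (bit A) I := by
    obtain ⟨R, hR, hsound, hlim⟩ := ce_univSet.exists_mono_eventually
    refine ⟨fun q => q.2.2.unpair.1.unpair.1 ≤ q.1 ∧
      q.2.2.unpair.1.unpair.2 = q.2.1 % 2 ^ q.2.2.unpair.1.unpair.1 ∧
      R (q.1, Nat.pair q.2.2.unpair.1.unpair.1 q.2.2.unpair.2), by fun_prop, fun x => ?_⟩
    constructor
    · rintro ⟨h1, h2⟩
      obtain ⟨s, h3, h4⟩ := ((hlim _).and (eventually_ge_atTop x.unpair.1.unpair.1)).exists
      exact ⟨s, h4, by simp only; rw [seg_mod _ h4, h1], h3.2 h2⟩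
    · rintro ⟨s, h1, h2, h3⟩
      simp only at h1 h2 h3
      rw [seg_mod _ h1] at h2
      exact ⟨h2, hsound _ _ h3⟩
  have hwt : wt I ≤ 1 := by
    refine le_trans ?_ wt_univSet_le
    refine wt_le_of_exists (fun y : univSet => (y : ℕ))
      (fun x => Nat.pair x.unpair.1.unpair.1 x.unpair.2) ?_ ?_
    · rintro x ⟨hx, -⟩ y ⟨hy, -⟩ hxy
      obtain ⟨h1, h2⟩ := Nat.pair_eq_pair.1 hxy
      rw [← Nat.pair_unpair x, ← Nat.pair_unpair y, h2, ← Nat.pair_unpair x.unpair.1,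
        ← Nat.pair_unpair y.unpair.1, hx, hy, h1]
    · rintro x ⟨-, hx⟩
      exact ⟨⟨_, hx⟩, rfl, by simp⟩
  obtain ⟨J, hJ, hIJ, hJwt⟩ := exists_ce_superset h hI hwt
  obtain ⟨B, hB⟩ := exists_segCount_cost_le hJ hJwt
  obtain ⟨P, hP, hPlt, hPlim⟩ := exists_approx_cost
  obtain ⟨R, hR, hsound, hlim⟩ := hJ.exists_mono_eventually
  refine exists_approx_of_bounded hB (Eventually.of_forall fun l => hIJ ?_)
    (P := fun x => ∃ k < x.1, P (x.1, x.2.1, k) ∧ R (x.1, Nat.pair (Nat.pair x.2.1 x.2.2) k)) ?_ ?_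
  · simp [I, pair_cost_mem]
  · exact PrimrecPred.exists_lt' (by fun_prop) (by fun_prop)
  · intro l v
    filter_upwards [hPlim l, hlim (Nat.pair (Nat.pair l v) (cost l))] with t h1 h2
    rw [← h2]
    constructor
    · rintro ⟨k, -, h3, h4⟩
      rwa [(h1 k).1 h3] at h4
    · intro h3
      have h4 := (h1 (cost l)).2 rfl
      exact ⟨_, hPlt _ _ _ h4, h4, h3⟩

end Limit

section Cover

variable {α : ℕ → Bool} {R : ℕ × ℕ × ℕ × ℕ → Prop} {V : ℕ → Set (ℕ → Bool)} {J : Set ℕ}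

/-- The number coding the string `v` of length `l`, as an element of the `n`-th component of a test,
together with its weight `2⁻⁽ˡ⁺ⁿ⁺¹⁾`. -/
def stringCode (n l v : ℕ) : ℕ := Nat.pair (Nat.pair n (Nat.pair l v)) (l + n + 1)

theorem stringCode_inj {n l v n' l' v' : ℕ} :
    stringCode n l v = stringCode n' l' v' ↔ n = n' ∧ l = l' ∧ v = v' := by
  simp only [stringCode, Nat.pair_eq_pair]
  omega

@[fun_prop] theorem primrec_stringCode {β : Type*} [Primcodable β] {n l v : β → ℕ}
    (hn : Primrec n) (hl : Primrec l) (hv : Primrec v) :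
    Primrec fun b => stringCode (n b) (l b) (v b) := by
  unfold stringCode
  fun_prop

/-- The codes of the minimal strings enumerated into the components of a test. -/
def newCodes (α : ℕ → Bool) (R : ℕ × ℕ × ℕ × ℕ → Prop) : Set ℕ :=
  {x | ∃ n l v, x = stringCode n l v ∧ New R (l, seg α l, n, v)}

theorem ceRel_newCodes (hR : PrimrecPred R) : CeRel α (newCodes α R) := by
  have hnew := primrecPred_new hR
  refine ⟨fun q => ∃ n < q.1, ∃ l < q.1, ∃ v < q.1, q.2.2 = stringCode n l v ∧
    New R (l, q.2.1 % 2 ^ l, n, v), ?_, fun x => ?_⟩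
  · refine PrimrecPred.exists_lt' (PrimrecPred.exists_lt' (PrimrecPred.exists_lt' ?_
      (by fun_prop)) (by fun_prop)) (by fun_prop)
    fun_prop
  · constructor
    · rintro ⟨n, l, v, rfl, h⟩
      refine ⟨n + l + v + 1, n, by simp only; omega, l, by simp only; omega, v,
        by simp only; omega, rfl, ?_⟩
      simp only
      rwa [seg_mod _ (by omega)]
    · rintro ⟨s, n, -, l, hl, v, -, rfl, h⟩
      simp only at h
      rw [seg_mod _ hl.le] at h
      exact ⟨n, l, v, rfl, h⟩

theorem wt_newCodes_le (hV : Rep α V R) (hm : MonoRep α R) : wt (newCodes α R) ≤ 1 := by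
  calc wt (newCodes α R) ≤ ∑' y : (Σ n : ℕ, {p : ℕ × ℕ | New R (p.1, seg α p.1, n, p.2)}),
        2⁻¹ ^ (y.1 + 1) * 2⁻¹ ^ (y.2 : ℕ × ℕ).1 := by
        refine wt_le_of_exists (fun y => stringCode y.1 (y.2 : ℕ × ℕ).1 (y.2 : ℕ × ℕ).2) id
          Function.injective_id.injOn ?_
        rintro x ⟨n, l, v, rfl, h⟩
        refine ⟨⟨n, (l, v), h⟩, rfl, ?_⟩
        simp only [stringCode, Nat.unpair_pair, ← pow_add]
        rw [show n + 1 + l = l + n + 1 by omega]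
    _ = ∑' n : ℕ, 2⁻¹ ^ (n + 1) *
          ∑' p : {p : ℕ × ℕ | New R (p.1, seg α p.1, n, p.2)}, 2⁻¹ ^ (p : ℕ × ℕ).1 := by
        rw [ENNReal.tsum_sigma']
        simp only [ENNReal.tsum_mul_left]
    _ ≤ ∑' n : ℕ, 2⁻¹ ^ (n + 1) * 1 := by
        gcongr with n
        exact (tsum_new_le hV hm n).trans prob_le_one
    _ = 1 := by simp only [mul_one, tsum_inv_two_pow_succ]

theorem ae_finite_stringCode_mem (hJ : wt J ≠ ∞) (n : ℕ) :
    mu {X | ∃ᶠ l in atTop, stringCode n l (seg X l) ∈ J} = 0 := by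
  refine measure_setOfPred_frequently_eq_zero (ne_top_of_le_ne_top
    (ENNReal.mul_ne_top (a := 2 ^ (n + 1)) (by simp) hJ) ?_)
  calc ∑' l, mu {X | stringCode n l (seg X l) ∈ J}
      ≤ ∑' l, ∑' _ : {v | stringCode n l v ∈ J}, (2⁻¹ : ℝ≥0∞) ^ l := by
        refine ENNReal.tsum_le_tsum fun l => ?_
        refine le_trans (measure_mono (t := ⋃ v : {v | stringCode n l v ∈ J},
          {X | seg X l = v}) ?_) ((measure_iUnion_le _).trans
          (ENNReal.tsum_le_tsum fun v => mu_seg_eq_le l v))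
        intro X hX
        exact Set.mem_iUnion.2 ⟨⟨seg X l, hX⟩, rfl⟩
    _ = ∑' y : (Σ l, {v | stringCode n l v ∈ J}), (2⁻¹ : ℝ≥0∞) ^ y.1 :=
        (ENNReal.tsum_sigma' (f := fun y : (Σ l, {v | stringCode n l v ∈ J}) =>
          (2⁻¹ : ℝ≥0∞) ^ y.1)).symm
    _ ≤ ∑' x : J, 2 ^ (n + 1) * 2⁻¹ ^ (x : ℕ).unpair.2 := by
        refine tsum_le_tsum_of_exists (fun x : J => (x : ℕ))
          (q := fun y => stringCode n y.1 y.2) ?_ ?_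
        · rintro ⟨l, v, hv⟩ ⟨l', v', hv'⟩ h
          obtain ⟨-, h1, h2⟩ := stringCode_inj.1 h
          simp only at h1 h2
          subst h1 h2
          rfl
        · rintro ⟨l, v, hv⟩
          refine ⟨⟨_, hv⟩, rfl, le_of_eq ?_⟩
          simp only [stringCode, Nat.unpair_pair]
          rw [two_pow_mul_inv_two_pow (by omega), show l + n + 1 - (n + 1) = l by omega]
    _ = 2 ^ (n + 1) * wt J := by rw [ENNReal.tsum_mul_left, wt]

/-- According to the approximation `a` at stage `t` to its oracle, the string `v` of length `l` is
a minimal string enumerated into the `n`-th component of a test. -/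
def GuessNew (a : ℕ × ℕ → Prop) (R : ℕ × ℕ × ℕ × ℕ → Prop) (t n l v : ℕ) : Prop :=
  ∃ w < 2 ^ l, (∀ i < l, (w.testBit i = true ∧ a (t, i)) ∨ (w.testBit i = false ∧ ¬ a (t, i))) ∧
    New R (l, w, n, v)

theorem primrecPred_guessNew {a : ℕ × ℕ → Prop} (ha : PrimrecPred a) (hR : PrimrecPred R)
    {β : Type*} [Primcodable β] {t n l v : β → ℕ} (ht : Primrec t) (hn : Primrec n)
    (hl : Primrec l) (hv : Primrec v) :
    PrimrecPred fun b => GuessNew a R (t b) (n b) (l b) (v b) := by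
  have hnew := primrecPred_new hR
  refine PrimrecPred.exists_lt' (PrimrecPred.and (PrimrecPred.forall_lt'
    (R := fun (q : β × ℕ) i => (q.2.testBit i = true ∧ a (t q.1, i)) ∨
      (q.2.testBit i = false ∧ ¬ a (t q.1, i))) ?_ ?_) ?_) ?_
  all_goals fun_prop

theorem eventually_guessNew_iff {a : ℕ × ℕ → Prop}
    (ha : ∀ i, ∀ᶠ t in atTop, (a (t, i) ↔ α i = true)) (n l v : ℕ) :
    ∀ᶠ t in atTop, (GuessNew a R t n l v ↔ New R (l, seg α l, n, v)) := by
  filter_upwards [eventually_forall_lt l ha] with t ht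
  constructor
  · rintro ⟨w, hw, h1, h2⟩
    have : w = seg α l := by
      rw [← seg_testBit hw, seg_eq_iff]
      intro i hi
      rw [Bool.eq_iff_iff, ← ht i hi]
      rcases h1 i hi with h | h
      · exact iff_of_true h.1 h.2
      · exact iff_of_false (by rw [h.1]; exact Bool.false_ne_true) h.2
    rwa [← this]
  · refine fun h => ⟨_, seg_lt α l, fun i hi => ?_, h⟩
    rw [testBit_seg _ hi, ht i hi]
    cases α i <;> simp

/-- If the minimal strings of a test relative to a limit computable oracle are covered by an
effectively enumerable set of finite weight, then the test is covered by an unrelativized test. -/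
theorem exists_genMLTest_of_newCodes_subset {a : ℕ × ℕ → Prop} (ha : PrimrecPred a)
    (halim : ∀ i, ∀ᶠ t in atTop, (a (t, i) ↔ α i = true)) (hV : Rep α V R)
    (hnull : mu (⋂ n, V n) = 0) (hJ : Ce J) (hsub : newCodes α R ⊆ J) (hwt : wt J ≠ ∞) :
    ∃ U, GenMLTest ∅ U ∧ (⋂ n, V n) ⊆ ⋂ n, U n := by
  obtain ⟨S, hS, hsound, hlim⟩ := hJ.exists_mono_eventually
  let U : ℕ → Set (ℕ → Bool) := fun k => {X | ∀ n < k + 1, ∃ l,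
    stringCode n l (seg X l) ∈ J ∧ ∃ t, k ≤ t ∧ GuessNew a R t n l (seg X l)}
  have hU : Rep (bit ∅) U fun q => ∀ n < q.2.2.1 + 1, ∃ l < q.1,
      S (q.1, stringCode n l (q.2.2.2 % 2 ^ l)) ∧
      ∃ t < q.1, q.2.2.1 ≤ t ∧ GuessNew a R t n l (q.2.2.2 % 2 ^ l) := by
    constructor
    · refine PrimrecPred.forall_lt' (PrimrecPred.exists_lt' (PrimrecPred.and (by fun_prop)
        (PrimrecPred.exists_lt' (PrimrecPred.and (by fun_prop) ?_) (by fun_prop)))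
        (by fun_prop)) (by fun_prop)
      apply primrecPred_guessNew ha hV.1 <;> fun_prop
    · intro k X
      constructor
      · intro hX
        choose! l h1 t h2 h3 using hX
        obtain ⟨s, hs⟩ := (eventually_forall_lt (P := fun n s => n < k + 1 →
          l n < s ∧ t n < s ∧ S (s, stringCode n (l n) (seg X (l n)))) (k + 1) fun n => by
            filter_upwards [eventually_gt_atTop (l n), eventually_gt_atTop (t n),
              hlim (stringCode n (l n) (seg X (l n)))] with s h4 h5 h6 hn
            exact ⟨h4, h5, h6.2 (h1 n hn)⟩).exists
        refine ⟨s, fun n hn => ?_⟩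
        simp only at hn ⊢
        obtain ⟨h4, h5, h6⟩ := hs n hn hn
        refine ⟨l n, h4, ?_, t n, h5, h2 n hn, ?_⟩
        · rwa [seg_mod _ h4.le]
        · rw [seg_mod _ h4.le]
          exact h3 n hn
      · rintro ⟨s, hs⟩ n hn
        obtain ⟨l, h1, h2, t, -, h3, h4⟩ := hs n hn
        simp only at h1 h2 h3 h4
        rw [seg_mod _ h1.le] at h2 h4
        exact ⟨l, hsound _ _ h2, t, h3, h4⟩
  obtain ⟨W, hW, hUW⟩ := hU.exists_ceSeqIn
  refine ⟨U, ⟨W, hW, hUW, fun k X hX n hn => ?_, ?_⟩, fun X hX => ?_⟩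
  · obtain ⟨l, h1, t, h2, h3⟩ := hX n (by omega)
    exact ⟨l, h1, t, by omega, h3⟩
  · refine measure_mono_null (t := (⋂ n, V n) ∪
      ⋃ n, {X | ∃ᶠ l in atTop, stringCode n l (seg X l) ∈ J}) (fun X hX => ?_)
      (measure_union_null hnull (measure_iUnion_null (ae_finite_stringCode_mem hwt)))
    refine or_iff_not_imp_right.2 fun hfin => Set.mem_iInter.2 fun n => ?_
    simp only [Set.mem_iUnion, Set.mem_ofPred_eq, not_exists, not_frequently] at hfin
    obtain ⟨b, hb⟩ := eventually_atTop.1 (hfin n)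
    obtain ⟨s, hs⟩ := eventually_atTop.1 (eventually_forall_lt b fun l =>
      eventually_guessNew_iff (R := R) halim n l (seg X l))
    obtain ⟨l, h1, t, h2, h3⟩ := Set.mem_iInter.1 hX (s + n) n (by omega)
    have hl : l < b := by
      by_contra! h
      exact hb l h h1
    exact (hV.mem_iff_new n X).2 ⟨l, (hs t (by omega) l hl).1 h3⟩
  · refine Set.mem_iInter.2 fun k n hn => ?_
    obtain ⟨l, hl⟩ := (hV.mem_iff_new n X).1 (Set.mem_iInter.1 hX n)
    obtain ⟨t, h1, h2⟩ := ((eventually_guessNew_iff (R := R) halim n l (seg X l)).and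
      (eventually_ge_atTop k)).exists
    exact ⟨l, hsub ⟨n, l, _, rfl, hl⟩, t, h2, h1.2 hl⟩

end Cover

end

/-- If `A` is low for 1-randomness, then `A` is low for weak 2-random tests. -/
theorem lowForW2Tests_of_lowForRandomness (A : Set ℕ)
    (h : ∀ X : ℕ → Bool, MLRandom ∅ X → MLRandom A X) :
    LowForW2Tests A := by
  rintro V ⟨W, hW, hVW, -, hnull⟩
  obtain ⟨R₀, hR₀⟩ := hW.exists_rep
  obtain ⟨R, hR, hmono⟩ := hR₀.exists_mono
  have hV : V = fun n => Cyl (W n) := funext hVW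
  rw [← hV] at hR
  obtain ⟨J, hJ, hsub, hwt⟩ := exists_ce_superset h (ceRel_newCodes hR.1)
    (wt_newCodes_le hR hmono)
  obtain ⟨a, ha, halim⟩ := exists_approx h
  exact exists_genMLTest_of_newCodes_subset ha halim hR hnull hJ hsub hwt

end LMD
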